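/- Suppose W is finite with longest element w_S and J ⊆ S satisfies S∖J = {a,b} with a ≠ b; let d = d(S, ā, b) (where ū = w_S·u·w_S; note ā ≠ b̄, so the rotation sequence and d are defined). Then the set of core (I,J)-cosets (over all I ⊆ S) has exactly 2(d+1) elements; more precisely, there is exactly one such coset of atomic length 0, exactly one of atomic length d+1, and exactly two of atomic length k for each 1 ≤ k ≤ d. -/

import Mathlib

namespace CoxeterAtoms

variable {B : Type*} {W : Type*} [Group W] {M : CoxeterMatrix B}

/-- The standard parabolic subgroup `W_K` generated by the simple reflections indexed by `K`. -/
def par (cs : CoxeterSystem M W) (K : Set B) : Subgroup W :=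
  Subgroup.closure (cs.simple '' K)

/-- `K` is finitary if `W_K` is finite. -/
def Finitary (cs : CoxeterSystem M W) (K : Set B) : Prop :=
  ((par cs K : Set W)).Finite

/-- The left coset `W_I · x`. -/
def lcos (cs : CoxeterSystem M W) (I : Set B) (x : W) : Set W :=
  {w | ∃ a ∈ par cs I, w = a * x}

/-- The right coset `x · W_J`. -/
def rcos (cs : CoxeterSystem M W) (x : W) (J : Set B) : Set W :=
  {w | ∃ b ∈ par cs J, w = x * b}

/-- The double coset `W_I · x · W_J`. -/
def dcos (cs : CoxeterSystem M W) (I : Set B) (x : W) (J : Set B) : Set W :=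
  {w | ∃ a ∈ par cs I, ∃ b ∈ par cs J, w = a * x * b}

/-- `x` is a minimal length element of its double coset `W_I · x · W_J`. -/
def IsMinRep (cs : CoxeterSystem M W) (I : Set B) (x : W) (J : Set B) : Prop :=
  ∀ w ∈ dcos cs I x J, cs.length x ≤ cs.length w

/-- `y` is a maximal length element of the set `p`. -/
def IsMaxOf (cs : CoxeterSystem M W) (p : Set W) (y : W) : Prop :=
  y ∈ p ∧ ∀ w ∈ p, cs.length w ≤ cs.length y

/-- `y` is the longest element of the standard parabolic subgroup `W_K`. -/
def IsLongest (cs : CoxeterSystem M W) (K : Set B) (y : W) : Prop :=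
  y ∈ par cs K ∧ ∀ w ∈ par cs K, cs.length w ≤ cs.length y

/-- The double coset `W_I · x · W_J` is core: `W_I·x = W_I·x·W_J = x·W_J`. -/
def IsCore (cs : CoxeterSystem M W) (I : Set B) (x : W) (J : Set B) : Prop :=
  lcos cs I x = dcos cs I x J ∧ dcos cs I x J = rcos cs x J

/-- A reduced atomic expression `(L_0,…,L_m; s_1,…,s_m)` of width `m` from `I` to `J`,
together with the associated data: the removed letters `t_i`, the longest elements
`w_{L_i}` and `w_{K_i}` (where `K_i = L_{i-1} ∪ {s_i}`), and the partial products `x_i`. -/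
structure RAtomExpr (cs : CoxeterSystem M W) (I J : Set B) (m : ℕ) where
  Lset : ℕ → Set B
  letter : ℕ → B
  tletter : ℕ → B
  wL : ℕ → W
  wK : ℕ → W
  x : ℕ → W
  hL0 : Lset 0 = I
  hLm : Lset m = J
  hwL : ∀ i ≤ m, IsLongest cs (Lset i) (wL i)
  hmem : ∀ i, 1 ≤ i → i ≤ m → letter i ∉ Lset (i - 1)
  hfinK : ∀ i, 1 ≤ i → i ≤ m → Finitary cs (Lset (i - 1) ∪ {letter i})
  hwK : ∀ i, 1 ≤ i → i ≤ m → IsLongest cs (Lset (i - 1) ∪ {letter i}) (wK i)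
  ht : ∀ i, 1 ≤ i → i ≤ m →
    cs.simple (tletter i) = wK i * cs.simple (letter i) * wK i
  hLi : ∀ i, 1 ≤ i → i ≤ m → Lset i = (Lset (i - 1) ∪ {letter i}) \ {tletter i}
  hx0 : x 0 = wL 0
  hx : ∀ i, 1 ≤ i → i ≤ m → x i = x (i - 1) * wL (i - 1) * wK i
  hred : ∀ i, 1 ≤ i → i ≤ m →
    (cs.length (x i) : ℤ) =
      (cs.length (x (i - 1)) : ℤ) - cs.length (wL (i - 1)) + cs.length (wK i)

/-- The set of core `(I,J)`-cosets with fixed right index `J`, encoded as pairs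
`(I, x)` where `x` is the minimal element of the coset `W_I·x·W_J`. -/
def CoreRight (cs : CoxeterSystem M W) (J : Set B) : Set (Set B × W) :=
  {p | Finitary cs p.1 ∧ IsMinRep cs p.1 p.2 J ∧ IsCore cs p.1 p.2 J}

/-- The set of core `(I,M)`-cosets with fixed left index `I`, encoded as pairs
`(M, x)` where `x` is the minimal element of the coset `W_I·x·W_M`. -/
def CoreLeft (cs : CoxeterSystem M W) (I : Set B) : Set (Set B × W) :=
  {q | Finitary cs q.1 ∧ IsMinRep cs I q.2 q.1 ∧ IsCore cs I q.2 q.1}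

/-- The core coset encoded by the pair `p = (I, x)` (with right index `J`) has atomic
length `k`: some reduced atomic expression of width `k` from `I` to `J` expresses it,
i.e. ends at the maximal element `p̄` of the coset. -/
def AtLen (cs : CoxeterSystem M W) (J : Set B) (p : Set B × W) (k : ℕ) : Prop :=
  ∃ pbar : W, IsMaxOf cs (dcos cs p.1 p.2 J) pbar ∧
    ∃ E : RAtomExpr cs p.1 J k, E.x k = pbar


section Injective
open Classical

lemma refl_mul_pow {V : Type*} [AddCommGroup V] [Module ℝ V] {x y : V} {f g : Module.Dual ℝ V}
    (hf : f x = 2) (hg : g y = 2) (m : ℕ) (hm : 2 ≤ m)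
    (h1 : f y = - 2 * Real.cos (Real.pi / m)) (h2 : g x = - 2 * Real.cos (Real.pi / m)) :
    (Module.reflection hf * Module.reflection hg) ^ m = 1 := by
  ext z
  have ht : 2 * Real.cos (2 * Real.pi / m) = f y * g x - 2 := by
    rw [h1, h2, mul_div_assoc, Real.cos_two_mul]; ring
  rw [Module.reflection_mul_reflection_pow_apply hf hg m z _ ht]
  have hm0 : (m : ℝ) ≠ 0 := by positivity
  rcases Nat.eq_or_lt_of_le hm with rfl | hm3
  · have h1' : f y = 0 := by rw [h1]; simp
    have h2' : g x = 0 := by rw [h2]; simp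
    rw [ht, h1', h2']
    norm_num
    module
  · have hs : Real.sin (2 * Real.pi / m) ≠ 0 := by
      apply ne_of_gt
      apply Real.sin_pos_of_pos_of_lt_pi
      · positivity
      · rw [div_lt_iff₀ (by positivity)]
        have : (3 : ℝ) ≤ m := by exact_mod_cast hm3
        nlinarith [Real.pi_pos]
    have key := fun n : ℤ => Polynomial.Chebyshev.S_two_mul_real_cos (2 * Real.pi / m) n
    obtain ⟨n, hn | hn⟩ := Nat.even_or_odd' m
    · have e1 : (((m : ℤ) - 2) / 2) = n - 1 := by omega
      have e2 : (((m : ℤ) - 1) / 2) = n - 1 := by omega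
      have h0 : (Polynomial.Chebyshev.S ℝ ((n : ℤ) - 1)).eval (2 * Real.cos (2 * Real.pi / m)) = 0 := by
        have := key (n - 1)
        have e : ((((n : ℤ) - 1 : ℤ) : ℝ) + 1) * (2 * Real.pi / m) = Real.pi := by
          push_cast
          have : (m : ℝ) = 2 * n := by exact_mod_cast hn
          field_simp
          rw [this]; ring
        rw [e, Real.sin_pi] at this
        exact (mul_eq_zero.1 this).resolve_right hs
      rw [e1, e2, h0]
      simp
    · have e1 : (((m : ℤ) - 2) / 2) = n - 1 := by omega
      have e2 : (((m : ℤ) - 1) / 2) = n := by omega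
      have e3 : (((m : ℤ) - 3) / 2) = n - 1 := by omega
      have e4 : ((m : ℤ) / 2) = n := by omega
      have h0 : (Polynomial.Chebyshev.S ℝ (n : ℤ)).eval (2 * Real.cos (2 * Real.pi / m)) +
        (Polynomial.Chebyshev.S ℝ ((n : ℤ) - 1)).eval (2 * Real.cos (2 * Real.pi / m)) = 0 := by
        have k1 := key (n - 1)
        have k2 := key n
        have e : (((n : ℤ) : ℝ) + 1) * (2 * Real.pi / m) = 2 * Real.pi -
            ((((n : ℤ) - 1 : ℤ) : ℝ) + 1) * (2 * Real.pi / m) := by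
          push_cast
          have : (m : ℝ) = 2 * n + 1 := by exact_mod_cast hn
          field_simp
          rw [this]; ring
        rw [e, Real.sin_two_pi_sub] at k2
        have : ((Polynomial.Chebyshev.S ℝ (n : ℤ)).eval (2 * Real.cos (2 * Real.pi / m)) +
          (Polynomial.Chebyshev.S ℝ ((n : ℤ) - 1)).eval (2 * Real.cos (2 * Real.pi / m))) *
            Real.sin (2 * Real.pi / m) = 0 := by linarith
        exact (mul_eq_zero.1 this).resolve_right hs
      rw [e1, e2, e3, e4, h0]
      simp

/-- The coroot functional of the geometric representation. -/
noncomputable def coroot (M : CoxeterMatrix B) (i : B) : Module.Dual ℝ (B →₀ ℝ) :=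
  Finsupp.linearCombination ℝ (fun j => - 2 * Real.cos (Real.pi / (M i j)))

lemma coroot_single (M : CoxeterMatrix B) (i j : B) :
    coroot M i (Finsupp.single j 1) = - 2 * Real.cos (Real.pi / (M i j)) := by
  simp [coroot]

lemma coroot_self (M : CoxeterMatrix B) (i : B) : coroot M i (Finsupp.single i 1) = 2 := by
  rw [coroot_single]; simp

lemma geom_liftable (M : CoxeterMatrix B) :
    M.IsLiftable (fun i => Module.reflection (coroot_self M i)) := by
  intro i j
  by_cases hij : i = j
  · subst hij
    simp only [M.diagonal, pow_one]
    ext1 z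
    exact Module.involutive_reflection (coroot_self M i) z
  · by_cases h0 : M i j = 0
    · simp [h0]
    · apply refl_mul_pow
      · have := M.off_diagonal i j hij
        omega
      · rw [coroot_single]
      · rw [coroot_single, M.symmetric]

lemma simple_inj (cs : CoxeterSystem M W) : Function.Injective cs.simple := by
  intro i j hij
  by_contra hne
  have h := congrArg (cs.lift ⟨_, geom_liftable M⟩) hij
  rw [cs.lift_apply_simple, cs.lift_apply_simple] at h
  have h2 := congrArg (fun φ : (B →₀ ℝ) ≃ₗ[ℝ] (B →₀ ℝ) => φ (Finsupp.single i 1) i) h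
  simp [Module.reflection_apply, coroot_self, hne, Ne.symm hne] at h2
  norm_num at h2

end Injective



section Exchange
open Classical

/-- The involution of `W × ZMod 2` attached to a simple reflection. -/
noncomputable def piFun (cs : CoxeterSystem M W) (i : B) (p : W × ZMod 2) : W × ZMod 2 :=
  (cs.simple i * p.1 * cs.simple i, p.2 + if p.1 = cs.simple i then 1 else 0)

lemma piFun_invol (cs : CoxeterSystem M W) (i : B) (p : W × ZMod 2) :
    piFun cs i (piFun cs i p) = p := by
  obtain ⟨t, e⟩ := p
  have h : cs.simple i * t * cs.simple i = cs.simple i ↔ t = cs.simple i := by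
    constructor
    · intro h
      have : cs.simple i * (cs.simple i * t * cs.simple i) * cs.simple i
        = cs.simple i * cs.simple i * cs.simple i := by rw [h]
      simpa [mul_assoc] using this
    · rintro rfl; simp
  simp only [piFun, h]
  ext
  · simp [mul_assoc]
  · simp only
    split_ifs
    · rw [add_assoc]; simp [CharTwo.add_self_eq_zero]
    · simp

/-- The permutation version of `piFun`. -/
noncomputable def piPerm (cs : CoxeterSystem M W) (i : B) : Equiv.Perm (W × ZMod 2) :=
  ⟨piFun cs i, piFun cs i, piFun_invol cs i, piFun_invol cs i⟩

lemma piPerm_pow (cs : CoxeterSystem M W) (i j : B) (k : ℕ) (t : W) (e : ZMod 2) :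
    ((piPerm cs i * piPerm cs j) ^ k) (t, e) =
      ((cs.simple i * cs.simple j) ^ k * t * ((cs.simple i * cs.simple j) ^ k)⁻¹,
        e + ∑ n ∈ Finset.range (2 * k),
          if t = ((cs.simple i * cs.simple j) ^ n)⁻¹ * cs.simple j then 1 else 0) := by
  induction k with
  | zero => simp
  | succ k ih =>
    rw [pow_succ', Equiv.Perm.mul_apply, ih]
    set c := cs.simple i * cs.simple j with hc
    have hcj : cs.simple j * c = c⁻¹ * cs.simple j := by simp [hc, mul_assoc]
    have hcjk : ∀ k : ℕ, cs.simple j * c ^ k = (c ^ k)⁻¹ * cs.simple j := by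
      intro k
      induction k with
      | zero => simp
      | succ k ih =>
        rw [pow_succ, ← mul_assoc, ih, mul_assoc, hcj, ← pow_succ, pow_succ']; simp [mul_assoc]
    have e1 : c ^ k * t * (c ^ k)⁻¹ = cs.simple j ↔ t = (c ^ (2 * k))⁻¹ * cs.simple j := by
      rw [mul_inv_eq_iff_eq_mul, hcjk, ← eq_inv_mul_iff_mul_eq, ← mul_assoc, two_mul, pow_add,
        mul_inv_rev]
    have e2 : cs.simple j * (c ^ k * t * (c ^ k)⁻¹) * cs.simple j = cs.simple i ↔
        t = (c ^ (2 * k + 1))⁻¹ * cs.simple j := by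
      have hji : cs.simple j * cs.simple i = c⁻¹ := by simp [hc]
      have : cs.simple j * (c ^ k * t * (c ^ k)⁻¹) * cs.simple j = cs.simple i ↔
          c ^ k * t * (c ^ k)⁻¹ = c⁻¹ * cs.simple j := by
        rw [← hji]
        constructor
        · intro h; rw [← h]; simp [mul_assoc]
        · intro h; rw [h]; simp [mul_assoc]
      rw [this, mul_inv_eq_iff_eq_mul, mul_assoc, hcjk, ← eq_inv_mul_iff_mul_eq]
      have : (c ^ (2 * k + 1))⁻¹ * cs.simple j = (c ^ k)⁻¹ * (c⁻¹ * ((c ^ k)⁻¹ * cs.simple j)) := by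
        rw [two_mul, pow_succ, pow_add]
        simp only [mul_inv_rev, ← mul_assoc]
        congr 2
        rw [← mul_inv_rev, ← mul_inv_rev, ← pow_succ, ← pow_succ']
      rw [this]
    show piFun cs i (piFun cs j _) = _
    simp only [piFun, e1, e2]
    rw [show 2 * (k + 1) = 2 * k + 1 + 1 by ring, Finset.sum_range_succ, Finset.sum_range_succ]
    ext
    · simp [pow_succ', hc, mul_assoc]
    · simp [add_assoc]

lemma piPerm_liftable (cs : CoxeterSystem M W) : M.IsLiftable (piPerm cs) := by
  intro i j
  ext1 p
  obtain ⟨t, e⟩ := p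
  rw [piPerm_pow, two_mul, Finset.sum_range_add, cs.simple_mul_simple_pow]
  simp only [pow_add, cs.simple_mul_simple_pow, one_mul, CharTwo.add_self_eq_zero]
  simp

/-- The Tits permutation representation. -/
noncomputable def Phi (cs : CoxeterSystem M W) : W →* Equiv.Perm (W × ZMod 2) :=
  cs.lift ⟨piPerm cs, piPerm_liftable cs⟩

lemma Phi_word (cs : CoxeterSystem M W) (ω : List B) (t : W) (e : ZMod 2) :
    Phi cs (cs.wordProd ω) (t, e) =
      (cs.wordProd ω * t * (cs.wordProd ω)⁻¹, e + ((cs.rightInvSeq ω).count t : ZMod 2)) := by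
  induction ω with
  | nil => simp
  | cons i ω ih =>
    rw [cs.wordProd_cons, map_mul, Equiv.Perm.mul_apply, ih]
    have : Phi cs (cs.simple i) = piPerm cs i := cs.lift_apply_simple (piPerm_liftable cs) i
    rw [this]
    show piFun cs i _ = _
    have h : cs.wordProd ω * t * (cs.wordProd ω)⁻¹ = cs.simple i ↔
      (cs.wordProd ω)⁻¹ * cs.simple i * cs.wordProd ω = t := by
      constructor
      · intro h; rw [← h]; group
      · intro h; rw [← h]; group
    simp only [piFun, h, CoxeterSystem.rightInvSeq, List.count_cons, beq_iff_eq]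
    ext
    · simp [mul_assoc]
    · push_cast; simp [add_assoc]

/-- The inversion parity cocycle. -/
noncomputable def eta (cs : CoxeterSystem M W) (w t : W) : ZMod 2 := (Phi cs w (t, 0)).2

lemma Phi_eq (cs : CoxeterSystem M W) (w t : W) (e : ZMod 2) :
    Phi cs w (t, e) = (w * t * w⁻¹, e + eta cs w t) := by
  obtain ⟨ω, rfl⟩ := cs.wordProd_surjective w
  simp [eta, Phi_word]

lemma eta_mul (cs : CoxeterSystem M W) (v w t : W) :
    eta cs (v * w) t = eta cs w t + eta cs v (w * t * w⁻¹) := by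
  have := Phi_eq cs (v * w) t 0
  rw [map_mul, Equiv.Perm.mul_apply, Phi_eq, Phi_eq] at this
  simpa using (congrArg Prod.snd this).symm

lemma eta_simple (cs : CoxeterSystem M W) (i : B) : eta cs (cs.simple i) (cs.simple i) = 1 := by
  have := Phi_word cs [i] (cs.simple i) 0
  simp at this
  simp [eta, this]

lemma lt_of_eta (cs : CoxeterSystem M W) {w t : W} (h : eta cs w t = 1) :
    cs.length (w * t) < cs.length w := by
  obtain ⟨ω, hω, rfl⟩ := cs.exists_isReduced w
  have h2 := Phi_word cs ω t 0
  have h3 : ((cs.rightInvSeq ω).count t : ZMod 2) = 1 := by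
    rw [eta, h2] at h; simpa using h
  have : t ∈ cs.rightInvSeq ω := by
    by_contra hc
    rw [List.count_eq_zero_of_not_mem hc] at h3
    simp at h3
  exact (cs.isRightInversion_of_mem_rightInvSeq hω this).2

lemma eta_iff (cs : CoxeterSystem M W) {w : W} {i : B} :
    eta cs w (cs.simple i) = 1 ↔ cs.length (w * cs.simple i) < cs.length w := by
  refine ⟨lt_of_eta cs, fun h => ?_⟩
  by_contra hc
  have h0 : eta cs w (cs.simple i) = 0 := by
    generalize eta cs w (cs.simple i) = z at hc
    revert z; decide
  have : eta cs (w * cs.simple i) (cs.simple i) = 1 := by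
    rw [eta_mul, eta_simple]; simp [h0]
  have := lt_of_eta cs this
  simp at this
  omega

/-- Exchange, right version. -/
lemma exch (cs : CoxeterSystem M W) {y x : W} {i : B}
    (h1 : cs.length x < cs.length (x * cs.simple i))
    (h2 : cs.length (y * x * cs.simple i) < cs.length (y * x)) :
    cs.length (y * (x * cs.simple i * x⁻¹)) < cs.length y := by
  apply lt_of_eta
  have e2 := (eta_iff cs).2 h2
  rw [eta_mul] at e2
  have : eta cs x (cs.simple i) = 0 := by
    by_contra hc
    have : eta cs x (cs.simple i) = 1 := by
      generalize eta cs x (cs.simple i) = z at hc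
      revert z; decide
    have := lt_of_eta cs this
    omega
  simpa [this] using e2

end Exchange



section Parabolic

open Classical in
lemma mem_ris_of_lt (cs : CoxeterSystem M W) {ω : List B} {i : B}
    (h : cs.length (cs.wordProd ω * cs.simple i) < cs.length (cs.wordProd ω)) :
    cs.simple i ∈ cs.rightInvSeq ω := by
  have h1 := (eta_iff cs).2 h
  have h2 := Phi_word cs ω (cs.simple i) 0
  have h3 : ((cs.rightInvSeq ω).count (cs.simple i) : ZMod 2) = 1 := by
    rw [eta, h2] at h1; simpa using h1
  by_contra hc
  rw [List.count_eq_zero_of_not_mem hc] at h3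
  simp at h3

lemma simple_mem_par (cs : CoxeterSystem M W) {K : Set B} {i : B} (h : i ∈ K) :
    cs.simple i ∈ par cs K := Subgroup.subset_closure ⟨i, h, rfl⟩

lemma par_red (cs : CoxeterSystem M W) {K : Set B} {w : W} (hw : w ∈ par cs K) :
    ∃ ω : List B, (∀ i ∈ ω, i ∈ K) ∧ cs.wordProd ω = w ∧ ω.length = cs.length w := by
  have step : ∀ w : W, ∀ i ∈ K, (∃ ω : List B, (∀ i ∈ ω, i ∈ K) ∧ cs.wordProd ω = w ∧
      ω.length = cs.length w) → ∃ ω : List B, (∀ i ∈ ω, i ∈ K) ∧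
      cs.wordProd ω = w * cs.simple i ∧ ω.length = cs.length (w * cs.simple i) := by
    rintro w i hi ⟨ω, h1, rfl, h3⟩
    rcases cs.length_mul_simple (cs.wordProd ω) i with h | h
    · refine ⟨ω ++ [i], ?_, ?_, ?_⟩
      · intro j hj
        simp only [List.mem_append, List.mem_singleton] at hj
        rcases hj with hj | rfl
        · exact h1 j hj
        · exact hi
      · simp [cs.wordProd_append]
      · simp [h, h3]
    · have hm := mem_ris_of_lt cs (ω := ω) (i := i) (by omega)
      obtain ⟨j, hj, hj2⟩ := List.getElem_of_mem hm
      have hj' : j < ω.length := by simpa using hj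
      have h5 := cs.wordProd_mul_getD_rightInvSeq ω j
      rw [List.getD_eq_getElem _ _ hj, hj2] at h5
      refine ⟨ω.eraseIdx j, fun k hk => h1 k (List.mem_of_mem_eraseIdx hk), h5.symm, ?_⟩
      rw [List.length_eraseIdx_of_lt hj']
      omega
  induction hw using Subgroup.closure_induction_right with
  | one => exact ⟨[], by simp⟩
  | mul_right x hx y hy ih =>
    obtain ⟨i, hi, rfl⟩ := hy
    exact step x i hi ih
  | mul_inv_cancel x hx y hy ih =>
    obtain ⟨i, hi, rfl⟩ := hy
    rw [cs.inv_simple]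
    exact step x i hi ih

lemma par_ind (cs : CoxeterSystem M W) {K : Set B} (P : W → Prop) (one : P 1)
    (step : ∀ w ∈ par cs K, ∀ i ∈ K, cs.length (w * cs.simple i) = cs.length w + 1 → P w →
      P (w * cs.simple i)) : ∀ w ∈ par cs K, P w := by
  have main : ∀ ω : List B, (∀ i ∈ ω, i ∈ K) → ω.length = cs.length (cs.wordProd ω) →
      cs.wordProd ω ∈ par cs K ∧ P (cs.wordProd ω) := by
    intro ω
    induction ω using List.reverseRecOn with
    | nil => intro _ _; exact ⟨by simp [one_mem], by simpa using one⟩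
    | append_singleton ω i ih =>
      intro h1 h2
      have e : cs.wordProd (ω ++ [i]) = cs.wordProd ω * cs.simple i := by
        simp [cs.wordProd_append]
      rw [e] at h2 ⊢
      have h3 := cs.length_wordProd_le ω
      have h4 := cs.length_mul_simple (cs.wordProd ω) i
      simp only [List.length_append, List.length_singleton] at h2
      have h5 := ih (fun j hj => h1 j (by simp [hj])) (by omega)
      have hi : i ∈ K := h1 i (by simp)
      exact ⟨mul_mem h5.1 (simple_mem_par cs hi), step _ h5.1 i hi (by omega) h5.2⟩
  intro w hw
  obtain ⟨ω, h1, rfl, h3⟩ := par_red cs hw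
  exact (main ω h1 h3).2

lemma par_cases (cs : CoxeterSystem M W) {K : Set B} {w : W} (hw : w ∈ par cs K) :
    w = 1 ∨ ∃ i ∈ K, cs.length (w * cs.simple i) < cs.length w := by
  revert w
  apply par_ind
  · simp
  · intro w hw i hi h _
    right
    exact ⟨i, hi, by simp [h]⟩

lemma len_one_par (cs : CoxeterSystem M W) {K : Set B} {w : W} (hw : w ∈ par cs K)
    (h1 : cs.length w = 1) : ∃ i ∈ K, w = cs.simple i := by
  rcases par_cases cs hw with rfl | ⟨i, hi, h⟩
  · simp at h1
  · refine ⟨i, hi, ?_⟩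
    have : cs.length (w * cs.simple i) = 0 := by omega
    rw [cs.length_eq_zero_iff, mul_eq_one_iff_eq_inv, cs.inv_simple] at this
    exact this

lemma simple_mem_par_iff (cs : CoxeterSystem M W) {K : Set B} {i : B} :
    cs.simple i ∈ par cs K ↔ i ∈ K := by
  refine ⟨fun h => ?_, simple_mem_par cs⟩
  obtain ⟨j, hj, e⟩ := len_one_par cs h (cs.length_simple i)
  rwa [simple_inj cs e]

lemma par_mono (cs : CoxeterSystem M W) {K L : Set B} (h : K ⊆ L) : par cs K ≤ par cs L :=
  Subgroup.closure_mono (Set.image_mono h)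

lemma cosetmin_add (cs : CoxeterSystem M W) {K : Set B} {x : W}
    (h : ∀ w ∈ par cs K, cs.length x ≤ cs.length (x * w)) :
    ∀ w ∈ par cs K, cs.length (x * w) = cs.length x + cs.length w := by
  apply par_ind
  · simp
  · intro w hw i hi h1 ih
    rw [← mul_assoc]
    rcases cs.length_mul_simple (x * w) i with h2 | h2
    · omega
    · have := exch cs (y := x) (x := w) (i := i) (by omega) (by omega)
      have := h (w * cs.simple i * w⁻¹)
        (mul_mem (mul_mem hw (simple_mem_par cs hi)) (inv_mem hw))
      omega

lemma min_add (cs : CoxeterSystem M W) {K : Set B} {x : W}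
    (h : ∀ i ∈ K, cs.length x < cs.length (x * cs.simple i)) :
    ∀ w ∈ par cs K, cs.length (x * w) = cs.length x + cs.length w := by
  obtain ⟨w0, hw0, hmin⟩ : ∃ w0 ∈ par cs K, ∀ w ∈ par cs K,
      cs.length (x * w0) ≤ cs.length (x * w) := by
    have hwf := WellFounded.has_min (measure fun w : W => cs.length (x * w)).wf
      (par cs K : Set W) ⟨1, one_mem _⟩
    obtain ⟨m, hm, h2⟩ := hwf
    exact ⟨m, hm, fun w hw => not_lt.1 (h2 w hw)⟩
  have hy := cosetmin_add cs (K := K) (x := x * w0) (by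
    intro w hw
    rw [mul_assoc]
    exact hmin _ (mul_mem hw0 hw))
  rcases par_cases cs (inv_mem hw0) with h1 | ⟨i, hi, h1⟩
  · rw [inv_eq_one] at h1
    subst h1
    simpa using hy
  · exfalso
    have h2 := hy _ (inv_mem hw0)
    have h3 := hy _ (mul_mem (inv_mem hw0) (simple_mem_par cs hi))
    have h4 := h i hi
    rw [mul_inv_cancel_right] at h2
    rw [← mul_assoc, mul_inv_cancel_right] at h3
    omega

lemma max_sub (cs : CoxeterSystem M W) {K : Set B} {y : W}
    (h : ∀ i ∈ K, cs.length (y * cs.simple i) < cs.length y) :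
    ∀ w ∈ par cs K, cs.length (y * w) + cs.length w = cs.length y := by
  have main : ∀ w ∈ par cs K, cs.length (y * w⁻¹) + cs.length w = cs.length y := by
    apply par_ind
    · simp
    · intro w hw i hi h1 ih
      have := exch cs (y := y * w⁻¹) (x := w) (i := i) (by omega) (by simpa using h i hi)
      have e : y * w⁻¹ * (w * cs.simple i * w⁻¹) = y * (w * cs.simple i)⁻¹ := by
        simp [mul_assoc]
      rw [e] at this
      have h3 := cs.length_mul_le (y * (w * cs.simple i)⁻¹) (w * cs.simple i)
      rw [inv_mul_cancel_right] at h3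
      omega
  intro w hw
  simpa using main _ (inv_mem hw)

lemma long_desc (cs : CoxeterSystem M W) {K : Set B} {y : W} (h : IsLongest cs K y) :
    ∀ i ∈ K, cs.length (y * cs.simple i) < cs.length y := by
  intro i hi
  have h1 := h.2 _ (mul_mem h.1 (simple_mem_par cs hi))
  have h2 := cs.length_mul_simple_ne y i
  omega

lemma long_sub (cs : CoxeterSystem M W) {K : Set B} {y w : W} (h : IsLongest cs K y)
    (hw : w ∈ par cs K) : cs.length (y * w) + cs.length w = cs.length y :=
  max_sub cs (long_desc cs h) w hw

lemma long_uniq (cs : CoxeterSystem M W) {K : Set B} {y z : W} (hy : IsLongest cs K y)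
    (hz : IsLongest cs K z) : y = z := by
  have h1 := long_sub cs hy (mul_mem (inv_mem hy.1) hz.1)
  rw [mul_inv_cancel_left] at h1
  have h2 := hz.2 _ hy.1
  have h3 : cs.length (y⁻¹ * z) = 0 := by omega
  rw [cs.length_eq_zero_iff, inv_mul_eq_one] at h3
  exact h3

lemma long_inv (cs : CoxeterSystem M W) {K : Set B} {y : W} (hy : IsLongest cs K y) :
    y⁻¹ = y :=
  long_uniq cs ⟨inv_mem hy.1, fun w hw => by rw [cs.length_inv]; exact hy.2 w hw⟩ hy

lemma long_sq (cs : CoxeterSystem M W) {K : Set B} {y : W} (hy : IsLongest cs K y) :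
    y * y = 1 := by
  nth_rewrite 1 [← long_inv cs hy]
  simp

lemma long_of_desc (cs : CoxeterSystem M W) {K : Set B} {y : W} (hy : y ∈ par cs K)
    (h : ∀ i ∈ K, cs.length (y * cs.simple i) < cs.length y) : IsLongest cs K y := by
  refine ⟨hy, fun w hw => ?_⟩
  have := max_sub cs h _ (mul_mem (inv_mem hy) hw)
  rw [mul_inv_cancel_left] at this
  omega

lemma long_sub_left (cs : CoxeterSystem M W) {K : Set B} {y w : W} (h : IsLongest cs K y)
    (hw : w ∈ par cs K) : cs.length (w * y) + cs.length w = cs.length y := by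
  have := long_sub cs h (inv_mem hw)
  rw [cs.length_inv] at this
  rw [← cs.length_inv (w * y), mul_inv_rev, long_inv cs h]
  exact this

lemma long_conj (cs : CoxeterSystem M W) {K : Set B} {y : W} (h : IsLongest cs K y) {i : B}
    (hi : i ∈ K) : ∃ k ∈ K, y * cs.simple i * y = cs.simple k := by
  have hs := simple_mem_par cs hi
  have h1 := long_sub_left cs h hs
  have h2 := long_sub cs h (mul_mem hs h.1)
  rw [cs.length_simple] at h1
  rw [← mul_assoc] at h2
  exact len_one_par cs (mul_mem (mul_mem h.1 hs) h.1) (by omega)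

lemma exists_long [Finite W] (cs : CoxeterSystem M W) (K : Set B) : ∃ y, IsLongest cs K y := by
  obtain ⟨m, hm, h⟩ := Set.exists_max_image (par cs K : Set W) cs.length (Set.toFinite _)
    ⟨1, one_mem _⟩
  exact ⟨m, hm, h⟩

/-- Factoring the longest element out on the right. -/
lemma fac (cs : CoxeterSystem M W) {K : Set B} {y v : W} (hv : IsLongest cs K v)
    (h : ∀ i ∈ K, cs.length (y * cs.simple i) < cs.length y) :
    cs.length (y * v) + cs.length v = cs.length y ∧
      ∀ i ∈ K, cs.length (y * v) < cs.length (y * v * cs.simple i) := by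
  have h0 := max_sub cs h v hv.1
  refine ⟨h0, fun i hi => ?_⟩
  have h1 := max_sub cs h (v * cs.simple i) (mul_mem hv.1 (simple_mem_par cs hi))
  have h2 := long_desc cs hv i hi
  rw [← mul_assoc] at h1
  omega

end Parabolic



section Core

/-- Elements `x`, minimal in `x W_J`, conjugating the simple reflections of `J` to simple ones. -/
def Xc (cs : CoxeterSystem M W) (J : Set B) (x : W) : Prop :=
  (∀ j ∈ J, cs.length x < cs.length (x * cs.simple j)) ∧
    ∀ j ∈ J, ∃ i, x * cs.simple j * x⁻¹ = cs.simple i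

/-- The conjugated subset. -/
def img (cs : CoxeterSystem M W) (J : Set B) (x : W) : Set B :=
  {i | ∃ j ∈ J, x * cs.simple j * x⁻¹ = cs.simple i}

lemma par_img (cs : CoxeterSystem M W) {J : Set B} {x : W}
    (h : ∀ j ∈ J, ∃ i, x * cs.simple j * x⁻¹ = cs.simple i) (g : W) :
    g ∈ par cs (img cs J x) ↔ ∃ w ∈ par cs J, g = x * w * x⁻¹ := by
  have e : par cs (img cs J x) = (par cs J).map (MulAut.conj x).toMonoidHom := by
    rw [par, par, MonoidHom.map_closure]
    congr 1
    ext g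
    simp only [Set.mem_image, img, Set.mem_ofPred_eq]
    constructor
    · rintro ⟨i, ⟨j, hj, e⟩, rfl⟩
      exact ⟨cs.simple j, ⟨j, hj, rfl⟩, by simpa using e⟩
    · rintro ⟨_, ⟨j, hj, rfl⟩, rfl⟩
      obtain ⟨i, hi⟩ := h j hj
      exact ⟨i, ⟨j, hj, hi⟩, by simpa using hi.symm⟩
  rw [e, Subgroup.mem_map]
  constructor
  · rintro ⟨w, hw, rfl⟩; exact ⟨w, hw, by simp⟩
  · rintro ⟨w, hw, rfl⟩; exact ⟨w, hw, by simp⟩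

lemma conj_long (cs : CoxeterSystem M W) {J : Set B} {x v : W}
    (h : ∀ j ∈ J, ∃ i, x * cs.simple j * x⁻¹ = cs.simple i)
    (hl : ∀ w ∈ par cs J, cs.length (x * w * x⁻¹) = cs.length w) (hv : IsLongest cs J v) :
    IsLongest cs (img cs J x) (x * v * x⁻¹) := by
  refine ⟨(par_img cs h _).2 ⟨v, hv.1, rfl⟩, fun g hg => ?_⟩
  obtain ⟨w, hw, rfl⟩ := (par_img cs h _).1 hg
  rw [hl w hw, hl v hv.1]
  exact hv.2 w hw

lemma Xc_left_add (cs : CoxeterSystem M W) {J : Set B} {x : W} (hx : Xc cs J x) {w : W}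
    (hw : w ∈ par cs J) :
    cs.length (x * w) = cs.length (x * w * x⁻¹) + cs.length x := by
  have hmin : ∀ i ∈ img cs J x, cs.length x⁻¹ < cs.length (x⁻¹ * cs.simple i) := by
    rintro i ⟨j, hj, e⟩
    have : x⁻¹ * cs.simple i = (x * cs.simple j)⁻¹ := by
      rw [← cs.inv_simple i, ← mul_inv_rev, ← e]; group
    rw [this, cs.length_inv, cs.length_inv]
    exact hx.1 j hj
  have := min_add cs hmin _ (inv_mem ((par_img cs hx.2 _).2 ⟨w, hw, rfl⟩))
  rw [← mul_inv_rev, cs.length_inv, cs.length_inv, cs.length_inv, inv_mul_cancel_right] at this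
  omega

lemma Xc_len (cs : CoxeterSystem M W) {J : Set B} {x : W} (hx : Xc cs J x) :
    ∀ w ∈ par cs J, cs.length (x * w * x⁻¹) = cs.length w := by
  intro w hw
  have h1 := Xc_left_add cs hx hw
  have h2 := min_add cs hx.1 w hw
  omega

lemma core_iff [Finite W] (cs : CoxeterSystem M W) (J : Set B) (p : Set B × W) :
    p ∈ CoreRight cs J ↔ Xc cs J p.2 ∧ p.1 = img cs J p.2 := by
  obtain ⟨I, x⟩ := p
  simp only [CoreRight, Set.mem_ofPred_eq]
  constructor
  · rintro ⟨-, hmin, hc1, hc2⟩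
    have hR : ∀ j ∈ J, cs.length x < cs.length (x * cs.simple j) := by
      intro j hj
      have h1 := hmin (x * cs.simple j) ⟨1, one_mem _, _, simple_mem_par cs hj, by simp⟩
      have h2 := cs.length_mul_simple_ne x j
      omega
    have hL : ∀ i ∈ I, cs.length x⁻¹ < cs.length (x⁻¹ * cs.simple i) := by
      intro i hi
      have h1 := hmin (cs.simple i * x) ⟨_, simple_mem_par cs hi, 1, one_mem _, by simp⟩
      have h2 := cs.length_simple_mul_ne x i
      rw [← cs.length_inv (x⁻¹ * cs.simple i), cs.length_inv]
      simp only [mul_inv_rev, cs.inv_simple, inv_inv]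
      omega
    have hconj : ∀ j ∈ J, ∃ i ∈ I, x * cs.simple j * x⁻¹ = cs.simple i := by
      intro j hj
      have h1 : x * cs.simple j ∈ lcos cs I x := by
        rw [hc1]; exact ⟨1, one_mem _, _, simple_mem_par cs hj, by simp⟩
      obtain ⟨g, hg, e⟩ := h1
      have h2 := min_add cs hL _ (inv_mem hg)
      rw [← mul_inv_rev, ← e, cs.length_inv, cs.length_inv, cs.length_inv] at h2
      have h3 := min_add cs hR _ (simple_mem_par cs hj)
      rw [cs.length_simple] at h3
      obtain ⟨i, hi, e2⟩ := len_one_par cs hg (by omega)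
      exact ⟨i, hi, by rw [e, ← e2]; group⟩
    refine ⟨⟨hR, fun j hj => ?_⟩, ?_⟩
    · obtain ⟨i, -, e⟩ := hconj j hj
      exact ⟨i, e⟩
    · ext i
      constructor
      · intro hi
        have h1 : cs.simple i * x ∈ rcos cs x J := by
          rw [← hc2]; exact ⟨_, simple_mem_par cs hi, 1, one_mem _, by simp⟩
        obtain ⟨g, hg, e⟩ := h1
        have h2 := min_add cs hR _ hg
        have h3 := min_add cs hL _ (simple_mem_par cs hi)
        rw [cs.length_simple, ← cs.length_inv, mul_inv_rev, inv_inv, cs.inv_simple, e,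
          cs.length_inv] at h3
        obtain ⟨j, hj, e2⟩ := len_one_par cs hg (by omega)
        exact ⟨j, hj, by rw [← e2, ← e]; group⟩
      · rintro ⟨j, hj, e⟩
        obtain ⟨i', hi', e'⟩ := hconj j hj
        rw [simple_inj cs (e.symm.trans e')]
        exact hi'
  · rintro ⟨hx, rfl⟩
    have key : ∀ g, g ∈ par cs (img cs J x) ↔ ∃ w ∈ par cs J, g = x * w * x⁻¹ :=
      par_img cs hx.2
    have hdr : dcos cs (img cs J x) x J = rcos cs x J := by
      ext w
      constructor
      · rintro ⟨g, hg, b, hb, rfl⟩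
        obtain ⟨v, hv, rfl⟩ := (key g).1 hg
        exact ⟨v * b, mul_mem hv hb, by group⟩
      · rintro ⟨b, hb, rfl⟩
        exact ⟨1, one_mem _, b, hb, by simp⟩
    refine ⟨Set.toFinite _, ?_, ?_, hdr⟩
    · intro w hw
      rw [hdr] at hw
      obtain ⟨b, hb, rfl⟩ := hw
      rw [min_add cs hx.1 b hb]
      omega
    · rw [hdr]
      ext w
      constructor
      · rintro ⟨g, hg, rfl⟩
        obtain ⟨v, hv, rfl⟩ := (key g).1 hg
        exact ⟨v, hv, by group⟩
      · rintro ⟨b, hb, rfl⟩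
        exact ⟨x * b * x⁻¹, (key _).2 ⟨b, hb, rfl⟩, by group⟩

lemma max_dcos [Finite W] (cs : CoxeterSystem M W) {J : Set B} {x y v : W} (hx : Xc cs J x)
    (hv : IsLongest cs J v) :
    IsMaxOf cs (dcos cs (img cs J x) x J) y ↔ y = x * v := by
  have hdr : dcos cs (img cs J x) x J = rcos cs x J :=
    ((core_iff cs J (img cs J x, x)).2 ⟨hx, rfl⟩).2.2.2
  rw [hdr]
  constructor
  · rintro ⟨⟨w, hw, rfl⟩, h2⟩
    have h3 := h2 _ ⟨v, hv.1, rfl⟩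
    rw [min_add cs hx.1 w hw, min_add cs hx.1 v hv.1] at h3
    rw [long_uniq cs (⟨hw, fun z hz => (hv.2 z hz).trans (by omega)⟩ : IsLongest cs J w) hv]
  · rintro rfl
    refine ⟨⟨v, hv.1, rfl⟩, ?_⟩
    rintro _ ⟨w, hw, rfl⟩
    rw [min_add cs hx.1 w hw, min_add cs hx.1 v hv.1]
    have := hv.2 w hw
    omega

lemma par_nondesc (cs : CoxeterSystem M W) {J : Set B} {i : B} (hi : i ∉ J) {w : W}
    (hw : w ∈ par cs J) : cs.length (w * cs.simple i) = cs.length w + 1 := by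
  have hmin : ∀ j ∈ J, cs.length (cs.simple i) < cs.length (cs.simple i * cs.simple j) := by
    intro j hj
    by_contra hc
    have h1 := cs.length_mul_simple (cs.simple i) j
    rw [cs.length_simple] at h1 hc
    have : cs.length (cs.simple i * cs.simple j) = 0 := by omega
    rw [cs.length_eq_zero_iff, mul_eq_one_iff_eq_inv, cs.inv_simple] at this
    exact hi (simple_inj cs this ▸ hj)
  have := min_add cs hmin _ (inv_mem hw)
  rw [← cs.length_inv, mul_inv_rev, inv_inv, cs.inv_simple, cs.length_inv, cs.length_simple] at this
  omega

lemma Xc_desc (cs : CoxeterSystem M W) {J : Set B} {x v : W} (hx : Xc cs J x)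
    (hv : IsLongest cs J v) {i : B} (hi : i ∉ J) :
    cs.length (x * v * cs.simple i) < cs.length (x * v) ↔
      cs.length (x * cs.simple i) < cs.length x := by
  constructor
  · intro h
    by_contra hc
    have hne := cs.length_mul_simple_ne x i
    have hmin : ∀ j ∈ insert i J, cs.length x < cs.length (x * cs.simple j) := by
      rintro j (rfl | hj)
      · omega
      · exact hx.1 j hj
    have hv' : v ∈ par cs (insert i J) := par_mono cs (Set.subset_insert i J) hv.1
    have h1 := min_add cs hmin v hv'
    have h2 := min_add cs hmin (v * cs.simple i)
      (mul_mem hv' (simple_mem_par cs (Set.mem_insert i J)))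
    have h3 := par_nondesc cs hi hv.1
    rw [← mul_assoc] at h2
    omega
  · intro h
    have h1 := Xc_left_add cs hx hv.1
    have e : x * v * cs.simple i = (x * v * x⁻¹) * (x * cs.simple i) := by group
    rw [e]
    have h2 := cs.length_mul_le (x * v * x⁻¹) (x * cs.simple i)
    omega

lemma Xc_descJ (cs : CoxeterSystem M W) {J : Set B} {x v : W} (hx : Xc cs J x)
    (hv : IsLongest cs J v) {i : B} (hi : i ∈ J) :
    cs.length (x * v * cs.simple i) < cs.length (x * v) := by
  have h2 := min_add cs hx.1 _ (mul_mem hv.1 (simple_mem_par cs hi))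
  have h1 := min_add cs hx.1 _ hv.1
  have h3 := long_desc cs hv i hi
  rw [← mul_assoc] at h2
  omega

lemma Xc_one (cs : CoxeterSystem M W) (J : Set B) : Xc cs J 1 :=
  ⟨by simp, fun j _ => ⟨j, by simp⟩⟩

lemma long_len_conj (cs : CoxeterSystem M W) {K : Set B} {v : W} (hv : IsLongest cs K v) :
    ∀ w ∈ par cs K, cs.length (v * w * v⁻¹) = cs.length w := by
  intro w hw
  have h1 := long_sub_left cs hv hw
  have h2 := long_sub cs hv (mul_mem hw hv.1)
  rw [long_inv cs hv, mul_assoc]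
  omega

end Core



section Rotation
open Classical

/-- A chosen longest element of `W_K`. -/
noncomputable def wl (cs : CoxeterSystem M W) (K : Set B) : W :=
  if h : ∃ y, IsLongest cs K y then h.choose else 1

lemma wl_spec [Finite W] (cs : CoxeterSystem M W) (K : Set B) : IsLongest cs K (wl cs K) := by
  have h := exists_long cs K
  rw [wl, dif_pos h]
  exact h.choose_spec

/-- Complement of a point. -/
def co1 (q : B) : Set B := Set.univ \ {q}
/-- Complement of a pair. -/
def co2 (p q : B) : Set B := Set.univ \ {p, q}

lemma mem_co1 {i q : B} : i ∈ co1 q ↔ i ≠ q := by simp [co1]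
lemma mem_co2 {i p q : B} : i ∈ co2 p q ↔ i ≠ p ∧ i ≠ q := by simp [co2]
lemma co2_comm (p q : B) : co2 p q = co2 q p := by ext; simp only [mem_co2, and_comm]
lemma co2_sub (p q : B) : co2 p q ⊆ co1 q := fun _ h => mem_co1.2 (mem_co2.1 h).2

/-- The rotation of a letter. -/
noncomputable def tau (cs : CoxeterSystem M W) (p q : B) : B :=
  if h : ∃ t, cs.simple t = wl cs (co1 q) * cs.simple p * wl cs (co1 q) then h.choose else p

variable [Finite W] (cs : CoxeterSystem M W)

lemma tau_spec {p q : B} (h : p ≠ q) :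
    cs.simple (tau cs p q) = wl cs (co1 q) * cs.simple p * wl cs (co1 q) := by
  obtain ⟨k, hk, e⟩ := long_conj cs (wl_spec cs (co1 q)) (mem_co1.2 h)
  have h : ∃ t, cs.simple t = wl cs (co1 q) * cs.simple p * wl cs (co1 q) := ⟨k, e.symm⟩
  rw [tau, dif_pos h]
  exact h.choose_spec

lemma tau_spec' {p q : B} (h : p ≠ q) :
    cs.simple p = wl cs (co1 q) * cs.simple (tau cs p q) * wl cs (co1 q) := by
  have := long_sq cs (wl_spec cs (co1 q))
  rw [tau_spec cs h]
  calc cs.simple p = (wl cs (co1 q) * wl cs (co1 q)) * cs.simple p *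
        (wl cs (co1 q) * wl cs (co1 q)) := by simp [this]
    _ = _ := by simp only [mul_assoc]

lemma tau_ne {p q : B} (h : p ≠ q) : tau cs p q ≠ q := by
  obtain ⟨k, hk, e⟩ := long_conj cs (wl_spec cs (co1 q)) (mem_co1.2 h)
  rw [← tau_spec cs h] at e
  rw [simple_inj cs e]
  exact mem_co1.1 hk

lemma tau_eq {p q t : B} (h : p ≠ q)
    (e : cs.simple t = wl cs (co1 q) * cs.simple p * wl cs (co1 q)) : t = tau cs p q :=
  simple_inj cs (e.trans (tau_spec cs h).symm)

lemma conj_eq_of_img {J : Set B} {x : W} {K : Set B} (hx : Xc cs J x) (hK : img cs J x = K) :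
    wl cs K = x * wl cs J * x⁻¹ := by
  subst hK
  exact long_uniq cs (wl_spec cs _) (conj_long cs hx.2 (Xc_len cs hx) (wl_spec cs J))

/-- Conjugating by the longest element of `W_{S - q}` moves `S - {p,q}` to `S - {q,tau p q}`. -/
lemma img_wl {p q : B} (h : p ≠ q) :
    img cs (co2 p q) (wl cs (co1 q)) = co2 q (tau cs p q) := by
  have hK := wl_spec cs (co1 q)
  ext i
  rw [mem_co2]
  constructor
  · rintro ⟨j, hj, e⟩
    obtain ⟨hj1, hj2⟩ := mem_co2.1 hj
    obtain ⟨k, hk, e2⟩ := long_conj cs hK (mem_co1.2 hj2)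
    rw [long_inv cs hK, e2] at e
    have := simple_inj cs e
    subst this
    refine ⟨mem_co1.1 hk, ?_⟩
    rintro rfl
    rw [tau_spec cs h] at e2
    exact hj1 (simple_inj cs (mul_left_cancel (mul_right_cancel e2)))
  · rintro ⟨h1, h2⟩
    obtain ⟨k, hk, e2⟩ := long_conj cs hK (mem_co1.2 h1)
    have e3 : wl cs (co1 q) * cs.simple k * wl cs (co1 q) = cs.simple i := by
      rw [← e2]
      have := long_sq cs hK
      calc _ = (wl cs (co1 q) * wl cs (co1 q)) * cs.simple i *
            (wl cs (co1 q) * wl cs (co1 q)) := by simp only [mul_assoc]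
        _ = _ := by simp [this]
    refine ⟨k, mem_co2.2 ⟨?_, mem_co1.1 hk⟩, by rw [long_inv cs hK]; exact e3⟩
    rintro rfl
    exact h2 (tau_eq cs h e3.symm)

lemma wl_conj {p q : B} (h : p ≠ q) :
    wl cs (co2 q (tau cs p q)) = wl cs (co1 q) * wl cs (co2 p q) * wl cs (co1 q) := by
  have hK := wl_spec cs (co1 q)
  have h1 : ∀ j ∈ co2 p q, ∃ i, wl cs (co1 q) * cs.simple j * (wl cs (co1 q))⁻¹ = cs.simple i := by
    intro j hj
    obtain ⟨k, _, e⟩ := long_conj cs hK (co2_sub p q hj)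
    exact ⟨k, by rw [long_inv cs hK]; exact e⟩
  have h2 := conj_long cs h1 (fun w hw => long_len_conj cs hK w (par_mono cs (co2_sub p q) hw))
    (wl_spec cs (co2 p q))
  rw [img_wl cs h] at h2
  rw [long_uniq cs (wl_spec cs _) h2, long_inv cs hK]

/-- The elementary step. -/
noncomputable def vv (cs : CoxeterSystem M W) (p q : B) : W := wl cs (co1 q) * wl cs (co2 p q)

lemma vv_def (p q : B) : vv cs p q = wl cs (co1 q) * wl cs (co2 p q) := rfl

lemma vv_mul (p q : B) : vv cs p q * wl cs (co2 p q) = wl cs (co1 q) := by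
  rw [vv, mul_assoc, long_sq cs (wl_spec cs _), mul_one]

lemma vv_eq {p q : B} (h : p ≠ q) :
    vv cs p q = wl cs (co2 q (tau cs p q)) * wl cs (co1 q) := by
  rw [wl_conj cs h, mul_assoc, long_sq cs (wl_spec cs _), mul_one, vv]

lemma mul_vv {p q : B} (h : p ≠ q) :
    wl cs (co2 q (tau cs p q)) * vv cs p q = wl cs (co1 q) := by
  rw [vv_eq cs h, ← mul_assoc, long_sq cs (wl_spec cs _), one_mul]

lemma vv_len (p q : B) :
    cs.length (vv cs p q) + cs.length (wl cs (co2 p q)) = cs.length (wl cs (co1 q)) :=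
  long_sub cs (wl_spec cs _) (par_mono cs (co2_sub p q) (wl_spec cs (co2 p q)).1)

lemma wl_len {p q : B} (h : p ≠ q) :
    cs.length (wl cs (co2 q (tau cs p q))) = cs.length (wl cs (co2 p q)) := by
  have h1 : wl cs (co2 q (tau cs p q)) ∈ par cs (co1 q) := by
    rw [co2_comm]
    exact par_mono cs (co2_sub _ _) (wl_spec cs _).1
  have h2 := long_sub_left cs (wl_spec cs (co1 q)) h1
  rw [← vv_eq cs h] at h2
  have := vv_len cs p q
  omega

lemma vv_desc {p q : B} (h : p ≠ q) :
    cs.length (vv cs p q * cs.simple p) < cs.length (vv cs p q) := by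
  have hK := wl_spec cs (co1 q)
  have hm := par_mono cs (co2_sub p q) (wl_spec cs (co2 p q)).1
  have h1 := long_sub cs hK hm
  have h2 := long_sub cs hK (mul_mem hm (simple_mem_par cs (mem_co1.2 h)))
  have h3 := par_nondesc cs (J := co2 p q) (i := p) (by simp [mem_co2]) (wl_spec cs (co2 p q)).1
  rw [← mul_assoc] at h2
  rw [vv]
  omega

lemma vv_pos {p q : B} (h : p ≠ q) : 0 < cs.length (vv cs p q) :=
  (Nat.zero_le _).trans_lt (vv_desc cs h)

/-- `vv p q` moves `S - {p,q}` to `S - {q, tau p q}`. -/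
lemma vv_conj {p q : B} (h : p ≠ q) {j : B} (hj : j ∈ co2 p q) :
    ∃ l ∈ co2 q (tau cs p q), vv cs p q * cs.simple j * (vv cs p q)⁻¹ = cs.simple l := by
  obtain ⟨k, hk, e⟩ := long_conj cs (wl_spec cs (co2 p q)) hj
  obtain ⟨i, hi, e2⟩ := long_conj cs (wl_spec cs (co1 q)) (co2_sub p q hk)
  refine ⟨i, ?_, ?_⟩
  · rw [← img_wl cs h]
    exact ⟨k, hk, by rw [long_inv cs (wl_spec cs _)]; exact e2⟩
  · rw [← e2, ← e, vv, mul_inv_rev, long_inv cs (wl_spec cs _), long_inv cs (wl_spec cs _)]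
    simp only [mul_assoc]

lemma vv_conj' {p q : B} (h : p ≠ q) {l : B} (hl : l ∈ co2 q (tau cs p q)) :
    ∃ j ∈ co2 p q, vv cs p q * cs.simple j * (vv cs p q)⁻¹ = cs.simple l := by
  rw [← img_wl cs h] at hl
  obtain ⟨k, hk, e⟩ := hl
  obtain ⟨j, hj, e2⟩ := long_conj cs (wl_spec cs (co2 p q)) hk
  refine ⟨j, hj, ?_⟩
  rw [← e2, ← e, vv, mul_inv_rev, long_inv cs (wl_spec cs _), long_inv cs (wl_spec cs _)]
  have := long_sq cs (wl_spec cs (co2 p q))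
  calc _ = wl cs (co1 q) * ((wl cs (co2 p q) * wl cs (co2 p q)) * cs.simple k *
        (wl cs (co2 p q) * wl cs (co2 p q))) * wl cs (co1 q) := by simp only [mul_assoc]
    _ = _ := by simp [this, mul_assoc]

/-- Products of elementary steps. -/
noncomputable def FF (cs : CoxeterSystem M W) : ℕ → B → B → W
  | 0, _, _ => 1
  | k + 1, p, q => FF cs k q (tau cs p q) * vv cs p q

/-- Expected length. -/
noncomputable def Lam (cs : CoxeterSystem M W) : ℕ → B → B → ℕ
  | 0, _, _ => 0
  | k + 1, p, q => Lam cs k q (tau cs p q) + cs.length (vv cs p q)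

/-- The rotation sequence. -/
noncomputable def useq (cs : CoxeterSystem M W) (p q : B) : ℕ → B
  | 0 => p
  | 1 => q
  | n + 2 => tau cs (useq cs p q n) (useq cs p q (n + 1))

/-- Reducedness of the product of steps. -/
def Good (cs : CoxeterSystem M W) (k : ℕ) (p q : B) : Prop :=
  cs.length (FF cs k p q * wl cs (co2 p q)) = Lam cs k p q + cs.length (wl cs (co2 p q))

lemma FF_seq (k : ℕ) : ∀ (u : ℕ → B), (∀ i, u (i + 2) = tau cs (u i) (u (i + 1))) →
    FF cs (k + 1) (u 0) (u 1) = vv cs (u k) (u (k + 1)) * FF cs k (u 0) (u 1) ∧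
    Lam cs (k + 1) (u 0) (u 1) = Lam cs k (u 0) (u 1) + cs.length (vv cs (u k) (u (k + 1))) := by
  induction k with
  | zero => intro u hu; simp [FF, Lam]
  | succ k ih =>
    intro u hu
    have h := ih (fun i => u (i + 1)) (fun i => hu (i + 1))
    have h0 := hu 0
    simp only [zero_add] at h0 h
    have a1 : FF cs (k + 1 + 1) (u 0) (u 1) = FF cs (k + 1) (u 1) (u 2) * vv cs (u 0) (u 1) := by
      rw [h0]; rfl
    have a2 : Lam cs (k + 1 + 1) (u 0) (u 1) =
        Lam cs (k + 1) (u 1) (u 2) + cs.length (vv cs (u 0) (u 1)) := by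
      rw [h0]; rfl
    have b1 : FF cs (k + 1) (u 0) (u 1) = FF cs k (u 1) (u 2) * vv cs (u 0) (u 1) := by
      rw [h0]; rfl
    have b2 : Lam cs (k + 1) (u 0) (u 1) =
        Lam cs k (u 1) (u 2) + cs.length (vv cs (u 0) (u 1)) := by
      rw [h0]; rfl
    have h1 := h.1
    have h2 := h.2
    simp only [Nat.reduceAdd] at h1 h2
    constructor
    · rw [a1, b1, h1, mul_assoc]
    · rw [a2, b2, h2]; omega

lemma useq_ne {p q : B} (h : p ≠ q) (n : ℕ) : useq cs p q n ≠ useq cs p q (n + 1) := by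
  induction n with
  | zero => exact h
  | succ n ih => exact (tau_ne cs ih).symm

lemma FF_succ (k : ℕ) (p q : B) : FF cs (k + 1) p q =
    vv cs (useq cs p q k) (useq cs p q (k + 1)) * FF cs k p q :=
  (FF_seq cs k (useq cs p q) (fun _ => rfl)).1

lemma Lam_succ (k : ℕ) (p q : B) : Lam cs (k + 1) p q =
    Lam cs k p q + cs.length (vv cs (useq cs p q k) (useq cs p q (k + 1))) :=
  (FF_seq cs k (useq cs p q) (fun _ => rfl)).2

lemma FF_le (k : ℕ) (p q : B) : cs.length (FF cs k p q) ≤ Lam cs k p q := by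
  induction k with
  | zero => simp [FF, Lam]
  | succ k ih =>
    rw [FF_succ, Lam_succ]
    have := cs.length_mul_le (vv cs (useq cs p q k) (useq cs p q (k + 1))) (FF cs k p q)
    omega

lemma Lam_lt {p q : B} (h : p ≠ q) : StrictMono (fun k => Lam cs k p q) := by
  apply strictMono_nat_of_lt_succ
  intro k
  rw [Lam_succ]
  have := vv_pos cs (useq_ne cs h k)
  omega

lemma Good_zero (p q : B) : Good cs 0 p q := by simp [Good, FF, Lam]

lemma Good_le_of (k : ℕ) (p q : B)
    (h : Lam cs k p q + cs.length (wl cs (co2 p q)) ≤ cs.length (FF cs k p q * wl cs (co2 p q))) :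
    Good cs k p q := by
  have h1 := cs.length_mul_le (FF cs k p q) (wl cs (co2 p q))
  have h2 := FF_le cs k p q
  unfold Good
  omega

lemma Good_pred {k : ℕ} {p q : B} (h : Good cs (k + 1) p q) : Good cs k p q := by
  apply Good_le_of
  unfold Good at h
  rw [FF_succ, Lam_succ, mul_assoc] at h
  have := cs.length_mul_le (vv cs (useq cs p q k) (useq cs p q (k + 1)))
    (FF cs k p q * wl cs (co2 p q))
  omega

lemma Good_mono {k l : ℕ} (hkl : k ≤ l) {p q : B} (h : Good cs l p q) : Good cs k p q := by
  induction hkl with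
  | refl => exact h
  | step _ ih => exact ih (Good_pred cs h)

lemma Good_len {k : ℕ} {p q : B} (h : Good cs k p q) :
    cs.length (FF cs k p q) = Lam cs k p q := by
  have h1 := cs.length_mul_le (FF cs k p q) (wl cs (co2 p q))
  have h2 := FF_le cs k p q
  unfold Good at h
  omega

lemma FF_conj (k : ℕ) : ∀ {p q : B}, p ≠ q → ∀ j ∈ co2 p q,
    ∃ i, FF cs k p q * cs.simple j * (FF cs k p q)⁻¹ = cs.simple i := by
  induction k with
  | zero => intro p q _ j _; exact ⟨j, by simp [FF]⟩
  | succ k ih =>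
    intro p q h j hj
    obtain ⟨l, hl, e⟩ := vv_conj cs h hj
    obtain ⟨i, hi⟩ := ih (tau_ne cs h).symm l hl
    refine ⟨i, ?_⟩
    rw [← hi, ← e, FF]
    group

lemma Good_Xc {k : ℕ} {p q : B} (hpq : p ≠ q) (h : Good cs k p q) :
    Xc cs (co2 p q) (FF cs k p q) := by
  refine ⟨fun j hj => ?_, FF_conj cs k hpq⟩
  by_contra hc
  have hne := cs.length_mul_simple_ne (FF cs k p q) j
  have h1 := Good_len cs h
  unfold Good at h
  have h2 := cs.length_mul_le (FF cs k p q * cs.simple j) (cs.simple j * wl cs (co2 p q))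
  have e : FF cs k p q * cs.simple j * (cs.simple j * wl cs (co2 p q)) =
    FF cs k p q * wl cs (co2 p q) := by simp [mul_assoc]
  rw [e] at h2
  have h3 := (wl_spec cs (co2 p q)).2 _ (mul_mem (simple_mem_par cs hj) (wl_spec cs (co2 p q)).1)
  omega

lemma Good_desc {k : ℕ} {p q : B} (hpq : p ≠ q) (h : Good cs (k + 1) p q) :
    cs.length (FF cs (k + 1) p q * cs.simple p) < cs.length (FF cs (k + 1) p q) := by
  rw [Good_len cs h, FF, Lam, mul_assoc]
  have h1 := cs.length_mul_le (FF cs k q (tau cs p q)) (vv cs p q * cs.simple p)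
  have h2 := vv_desc cs hpq
  have h3 := FF_le cs k q (tau cs p q)
  omega

lemma complete (n : ℕ) : ∀ {p q : B} {x : W}, p ≠ q → cs.length x = n → Xc cs (co2 p q) x →
    cs.length (x * cs.simple p) < cs.length x →
    ∃ k, Good cs (k + 1) p q ∧ x = FF cs (k + 1) p q := by
  induction n using Nat.strong_induction_on with
  | _ n ih =>
  intro p q x hpq hn hx hp
  have hJ := wl_spec cs (co2 p q)
  have hK := wl_spec cs (co1 q)
  have hdesc : ∀ i ∈ co1 q, cs.length (x * wl cs (co2 p q) * cs.simple i) <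
      cs.length (x * wl cs (co2 p q)) := by
    intro i hi
    by_cases hip : i = p
    · subst hip
      exact (Xc_desc cs hx hJ (by simp [mem_co2])).2 hp
    · exact Xc_descJ cs hx hJ (mem_co2.2 ⟨hip, mem_co1.1 hi⟩)
  obtain ⟨f1, f2⟩ := fac cs hK hdesc
  set x' := x * wl cs (co2 p q) * wl cs (co1 q) with hx'
  have hxe : x = x' * vv cs p q := by
    rw [hx', vv]
    calc x = x * wl cs (co2 p q) * wl cs (co2 p q) := by rw [mul_assoc, long_sq cs hJ, mul_one]
      _ = x * wl cs (co2 p q) * (wl cs (co1 q) * wl cs (co1 q)) * wl cs (co2 p q) := by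
        rw [long_sq cs hK, mul_one]
      _ = _ := by simp only [mul_assoc]
  have hadd := min_add cs hx.1 _ hJ.1
  have hvl := vv_len cs p q
  have hvp := vv_pos cs hpq
  have hX' : Xc cs (co2 q (tau cs p q)) x' := by
    constructor
    · intro j hj
      exact f2 j (mem_co1.2 (mem_co2.1 hj).1)
    · intro l hl
      obtain ⟨j, hj, e⟩ := vv_conj' cs hpq hl
      obtain ⟨i, hi⟩ := hx.2 j hj
      refine ⟨i, ?_⟩
      rw [← hi, ← e, hxe]
      group
  have finish : ∀ k, Lam cs k q (tau cs p q) = cs.length x' → x' = FF cs k q (tau cs p q) →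
      ∃ k, Good cs (k + 1) p q ∧ x = FF cs (k + 1) p q := by
    intro k h1 h2
    have h3 : x = FF cs (k + 1) p q := by rw [FF, ← h2]; exact hxe
    refine ⟨k, ?_, h3⟩
    unfold Good
    rw [← h3, Lam, h1]
    omega
  by_cases h1 : x' = 1
  · exact finish 0 (by simp [Lam, h1]) (by simp [FF, h1])
  · obtain ⟨i, hi⟩ := cs.exists_rightDescent_of_ne_one h1
    have hiq : i = q := by
      by_contra hc
      have := f2 i (mem_co1.2 hc)
      unfold CoxeterSystem.IsRightDescent at hi
      omega
    subst hiq
    obtain ⟨k, hk1, hk2⟩ := ih (cs.length x') (by omega) (tau_ne cs hpq).symm rfl hX' hi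
    exact finish (k + 1) (by rw [hk2, Good_len cs hk1]) hk2

end Rotation



section Top
open Classical
variable (cs : CoxeterSystem M W)

lemma mem_par_univ (w : W) : w ∈ par cs Set.univ := by
  rw [par, Set.image_univ, cs.subgroup_closure_range_simple]
  trivial

lemma long_univ {wS : W} (hwS : ∀ w : W, cs.length w ≤ cs.length wS) :
    IsLongest cs Set.univ wS := ⟨mem_par_univ cs wS, fun w _ => hwS w⟩

lemma wS_len {wS : W} (hw : IsLongest cs Set.univ wS) (g : W) :
    cs.length (wS * g) + cs.length g = cs.length wS := long_sub cs hw (mem_par_univ cs g)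

lemma wS_len_conj {wS : W} (hw : IsLongest cs Set.univ wS) (g : W) :
    cs.length (wS * g * wS) = cs.length g := by
  have := long_len_conj cs hw g (mem_par_univ cs g)
  rwa [long_inv cs hw] at this

lemma invol_Xc {wS : W} (hw : IsLongest cs Set.univ wS) {J : Set B} {v x : W}
    (hv : IsLongest cs J v) (hx : Xc cs J x) : Xc cs J (wS * x * v) := by
  constructor
  · intro j hj
    have h1 := Xc_descJ cs hx hv hj
    have h2 := wS_len cs hw (x * v)
    have h3 := wS_len cs hw (x * v * cs.simple j)
    simp only [mul_assoc] at *
    omega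
  · intro j hj
    obtain ⟨k, hk, e⟩ := long_conj cs hv hj
    obtain ⟨i, hi⟩ := hx.2 k hk
    obtain ⟨l, _, hl⟩ := long_conj cs hw (Set.mem_univ i)
    refine ⟨l, ?_⟩
    rw [← hl, ← hi, ← e, mul_inv_rev, mul_inv_rev, long_inv cs hv, long_inv cs hw]
    simp only [mul_assoc]

lemma invol_desc {wS : W} (hw : IsLongest cs Set.univ wS) {J : Set B} {v x : W}
    (hv : IsLongest cs J v) (hx : Xc cs J x) {i : B} (hi : i ∉ J) :
    cs.length (wS * x * v * cs.simple i) < cs.length (wS * x * v) ↔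
      ¬ cs.length (x * cs.simple i) < cs.length x := by
  rw [← Xc_desc cs hx hv hi]
  have h2 := wS_len cs hw (x * v)
  have h3 := wS_len cs hw (x * v * cs.simple i)
  have h4 := cs.length_mul_simple_ne (x * v) i
  simp only [mul_assoc] at *
  omega

variable [Finite W]

lemma both_desc {wS : W} (hw : IsLongest cs Set.univ wS) {p q : B} {x : W}
    (hx : Xc cs (co2 p q) x) (hp : cs.length (x * cs.simple p) < cs.length x)
    (hq : cs.length (x * cs.simple q) < cs.length x) : x = wS * wl cs (co2 p q) := by
  have hJ := wl_spec cs (co2 p q)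
  have : IsLongest cs Set.univ (x * wl cs (co2 p q)) := by
    apply long_of_desc cs (mem_par_univ cs _)
    intro i _
    by_cases h : i ∈ co2 p q
    · exact Xc_descJ cs hx hJ h
    · rw [Xc_desc cs hx hJ h]
      rw [mem_co2] at h
      by_cases h1 : i = p
      · rw [h1]; exact hp
      · have : i = q := by tauto
        rw [this]; exact hq
  rw [long_uniq cs hw this, mul_assoc, long_sq cs hJ, mul_one]

lemma top_desc {wS : W} (hw : IsLongest cs Set.univ wS) {J : Set B} {i : B} (hi : i ∉ J) :
    cs.length (wS * wl cs J * cs.simple i) < cs.length (wS * wl cs J) := by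
  have := (invol_desc cs hw (wl_spec cs J) (Xc_one cs J) hi).2 (by simp)
  simpa using this

lemma top_Xc {wS : W} (hw : IsLongest cs Set.univ wS) (J : Set B) : Xc cs J (wS * wl cs J) := by
  simpa using invol_Xc cs hw (wl_spec cs J) (Xc_one cs J)

lemma top_exists {wS : W} (hw : IsLongest cs Set.univ wS) {p q : B} (hpq : p ≠ q) :
    ∃ N, FF cs (N + 1) p q = wS * wl cs (co2 p q) ∧ ∀ k, Good cs k p q ↔ k ≤ N + 1 := by
  obtain ⟨N, h1, h2⟩ := complete cs _ hpq rfl (top_Xc cs hw (co2 p q))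
    (top_desc cs hw (by simp [mem_co2]))
  refine ⟨N, h2.symm, fun k => ⟨fun hk => ?_, fun hk => Good_mono cs hk h1⟩⟩
  have h3 : cs.length (FF cs k p q * wl cs (co2 p q)) ≤ cs.length wS := hw.2 _ (mem_par_univ cs _)
  have h4 : FF cs (N + 1) p q * wl cs (co2 p q) = wS := by
    rw [← h2, mul_assoc, long_sq cs (wl_spec cs _), mul_one]
  unfold Good at hk h1
  rw [h4] at h1
  have : Lam cs k p q ≤ Lam cs (N + 1) p q := by omega
  exact (Lam_lt cs hpq).le_iff_le.1 this

lemma FF_inj {p q : B} (hpq : p ≠ q) {k l : ℕ} (hk : Good cs k p q) (hl : Good cs l p q)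
    (h : FF cs k p q = FF cs l p q) : k = l := by
  apply (Lam_lt cs hpq).injective
  show Lam cs k p q = Lam cs l p q
  rw [← Good_len cs hk, ← Good_len cs hl, h]

/-- Below the top, `FF k p q` does not have `q` as descent. -/
lemma FF_not_desc {wS : W} (hw : IsLongest cs Set.univ wS) {p q : B} (hpq : p ≠ q) {N k : ℕ}
    (hN : FF cs (N + 1) p q = wS * wl cs (co2 p q)) (hG : ∀ k, Good cs k p q ↔ k ≤ N + 1)
    (hk : k ≤ N) : ¬ cs.length (FF cs k p q * cs.simple q) < cs.length (FF cs k p q) := by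
  intro hc
  have hg : Good cs k p q := (hG k).2 (by omega)
  cases k with
  | zero => simp [FF] at hc
  | succ k =>
    have := both_desc cs hw (Good_Xc cs hpq hg) (Good_desc cs hpq hg) hc
    rw [← hN] at this
    have := FF_inj cs hpq hg ((hG _).2 le_rfl) this
    omega

lemma N_le {wS : W} (hw : IsLongest cs Set.univ wS) {p q : B} (hpq : p ≠ q) {N N' : ℕ}
    (hN : FF cs (N + 1) p q = wS * wl cs (co2 p q)) (hG : ∀ k, Good cs k p q ↔ k ≤ N + 1)
    (hN' : FF cs (N' + 1) q p = wS * wl cs (co2 q p)) (hG' : ∀ k, Good cs k q p ↔ k ≤ N' + 1) :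
    N ≤ N' := by
  have hsub : (Finset.Icc 1 N).image (fun k => wS * FF cs k p q * wl cs (co2 p q)) ⊆
      (Finset.Icc 1 N').image (fun k => FF cs k q p) := by
    intro y hy
    rw [Finset.mem_image] at hy ⊢
    obtain ⟨k, hk, rfl⟩ := hy
    rw [Finset.mem_Icc] at hk
    have hg : Good cs k p q := (hG k).2 (by omega)
    have hx := Good_Xc cs hpq hg
    have hJ := wl_spec cs (co2 p q)
    have hX := invol_Xc cs hw hJ hx
    have hq := (invol_desc cs hw hJ hx (i := q) (by simp [mem_co2])).2
      (FF_not_desc cs hw hpq hN hG hk.2)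
    have hp : cs.length (FF cs k p q * cs.simple p) < cs.length (FF cs k p q) := by
      obtain ⟨k, rfl⟩ : ∃ l, k = l + 1 := ⟨k - 1, by omega⟩
      exact Good_desc cs hpq hg
    have hp' := (invol_desc cs hw hJ hx (i := p) (by simp [mem_co2])).not.2 (not_not.2 hp)
    have hX' : Xc cs (co2 q p) (wS * FF cs k p q * wl cs (co2 p q)) := by
      rw [co2_comm q p]; exact hX
    obtain ⟨l, hl1, hl2⟩ := complete cs _ hpq.symm rfl hX' hq
    refine ⟨l + 1, ?_, hl2.symm⟩
    rw [Finset.mem_Icc]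
    refine ⟨by omega, ?_⟩
    by_contra hc
    have h1 := (hG' _).1 hl1
    have h2 : l + 1 = N' + 1 := by omega
    rw [h2, hN'] at hl2
    rw [hl2] at hp'
    exact hp' (top_desc cs hw (by simp [mem_co2]))
  have h1 := Finset.card_le_card hsub
  rw [Finset.card_image_of_injOn, Nat.card_Icc] at h1
  · have h2 := Finset.card_image_le (s := Finset.Icc 1 N') (f := fun k => FF cs k q p)
    rw [Nat.card_Icc] at h2
    omega
  · intro k hk l hl h
    simp only [Finset.coe_Icc, Set.mem_Icc] at hk hl
    exact FF_inj cs hpq ((hG k).2 (by omega)) ((hG l).2 (by omega))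
      (mul_left_cancel (mul_right_cancel h))

lemma bar_wl {wS : W} (hw : IsLongest cs Set.univ wS) {K K' : Set B}
    (h : img cs K wS = K') : wl cs K' = wS * wl cs K * wS := by
  subst h
  have h1 : ∀ j ∈ K, ∃ i, wS * cs.simple j * wS⁻¹ = cs.simple i := by
    intro j _
    obtain ⟨k, _, e⟩ := long_conj cs hw (Set.mem_univ j)
    exact ⟨k, by rw [long_inv cs hw]; exact e⟩
  have h2 := conj_long cs h1 (fun w _ => long_len_conj cs hw w (mem_par_univ cs w)) (wl_spec cs K)
  rw [long_uniq cs (wl_spec cs _) h2, long_inv cs hw]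

lemma bar_symm {wS : W} (hw : IsLongest cs Set.univ wS) {g h : W} (e : g = wS * h * wS) :
    h = wS * g * wS := by
  have := long_sq cs hw
  rw [e]
  calc h = (wS * wS) * h * (wS * wS) := by simp [this]
    _ = _ := by simp only [mul_assoc]

lemma bar_img {wS : W} (hw : IsLongest cs Set.univ wS) {K K' : Set B}
    (h1 : ∀ i j, cs.simple i = wS * cs.simple j * wS → (j ∈ K ↔ i ∈ K')) :
    img cs K wS = K' := by
  ext i
  constructor
  · rintro ⟨j, hj, e⟩
    rw [long_inv cs hw] at e
    exact (h1 i j e.symm).1 hj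
  · intro hi
    obtain ⟨j, _, e⟩ := long_conj cs hw (Set.mem_univ i)
    have e2 := bar_symm cs hw e.symm
    exact ⟨j, (h1 i j e2).2 hi, by rw [long_inv cs hw]; exact e2.symm⟩

lemma bar_iff {wS : W} (hw : IsLongest cs Set.univ wS) {p p' i j : B}
    (hp : cs.simple p' = wS * cs.simple p * wS) (h : cs.simple i = wS * cs.simple j * wS) :
    j = p ↔ i = p' := by
  constructor
  · rintro rfl; exact simple_inj cs (h.trans hp.symm)
  · rintro rfl
    exact simple_inj cs ((bar_symm cs hw h).trans (bar_symm cs hw hp).symm)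

lemma bar_co1 {wS : W} (hw : IsLongest cs Set.univ wS) {p p' : B}
    (hp : cs.simple p' = wS * cs.simple p * wS) :
    wl cs (co1 p') = wS * wl cs (co1 p) * wS := by
  apply bar_wl cs hw (bar_img cs hw _)
  intro i j h
  rw [mem_co1, mem_co1, Ne, Ne, bar_iff cs hw hp h]

lemma bar_co2 {wS : W} (hw : IsLongest cs Set.univ wS) {p p' q q' : B}
    (hp : cs.simple p' = wS * cs.simple p * wS) (hq : cs.simple q' = wS * cs.simple q * wS) :
    wl cs (co2 p' q') = wS * wl cs (co2 p q) * wS := by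
  apply bar_wl cs hw (bar_img cs hw _)
  intro i j h
  rw [mem_co2, mem_co2, Ne, Ne, Ne, Ne, bar_iff cs hw hp h, bar_iff cs hw hq h]

lemma bar_mul {wS : W} (hw : IsLongest cs Set.univ wS) (g h : W) :
    (wS * g * wS) * (wS * h * wS) = wS * (g * h) * wS := by
  calc _ = wS * g * (wS * wS) * h * wS := by simp only [mul_assoc]
    _ = _ := by rw [long_sq cs hw, mul_one]; simp only [mul_assoc]

lemma bar_FF {wS : W} (hw : IsLongest cs Set.univ wS) (k : ℕ) : ∀ {p p' q q' : B}, p ≠ q →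
    cs.simple p' = wS * cs.simple p * wS → cs.simple q' = wS * cs.simple q * wS →
    FF cs k p' q' = wS * FF cs k p q * wS ∧ Lam cs k p' q' = Lam cs k p q := by
  induction k with
  | zero => intros; simp [FF, Lam, long_sq cs hw]
  | succ k ih =>
    intro p p' q q' hpq hp hq
    have hpq' : p' ≠ q' := fun h => hpq ((bar_iff cs hw hq hp).2 h)
    have ht : cs.simple (tau cs p' q') = wS * cs.simple (tau cs p q) * wS := by
      rw [tau_spec cs hpq, tau_spec cs hpq', bar_co1 cs hw hq, hp, bar_mul cs hw, bar_mul cs hw]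
    have hv : vv cs p' q' = wS * vv cs p q * wS := by
      rw [vv, vv, bar_co1 cs hw hq, bar_co2 cs hw hp hq, bar_mul cs hw]
    obtain ⟨h1, h2⟩ := ih (tau_ne cs hpq).symm hq ht
    rw [FF, FF, Lam, Lam, h1, h2, hv, bar_mul cs hw, wS_len_conj cs hw]
    exact ⟨rfl, rfl⟩

lemma bar_Good {wS : W} (hw : IsLongest cs Set.univ wS) (k : ℕ) {p p' q q' : B} (hpq : p ≠ q)
    (hp : cs.simple p' = wS * cs.simple p * wS) (hq : cs.simple q' = wS * cs.simple q * wS) :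
    Good cs k p' q' ↔ Good cs k p q := by
  obtain ⟨h1, h2⟩ := bar_FF cs hw k hpq hp hq
  unfold Good
  rw [h1, h2, bar_co2 cs hw hp hq, bar_mul cs hw, wS_len_conj cs hw, wS_len_conj cs hw]

lemma d_good (wco : B → W) (hwco : ∀ c, IsLongest cs (Set.univ \ {c}) (wco c))
    (wco2 : B → B → W) (hwco2 : ∀ c c', IsLongest cs (Set.univ \ {c, c'}) (wco2 c c'))
    (u : ℕ → B) (hu : u 0 ≠ u 1)
    (hurec : ∀ i, cs.simple (u (i + 2)) = wco (u (i + 1)) * cs.simple (u i) * wco (u (i + 1)))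
    (x : ℕ → W)
    (hx0 : x 0 = wco2 (u 0) (u 1))
    (hx : ∀ i, x (i + 1) = x i * wco2 (u i) (u (i + 1)) * wco (u (i + 1))) (k : ℕ) :
    (∀ i < k, (cs.length (x (i + 1)) : ℤ) =
      (cs.length (x i) : ℤ) - cs.length (wco2 (u i) (u (i + 1))) + cs.length (wco (u (i + 1)))) ↔
    Good cs k (u 0) (u 1) := by
  have e1 : ∀ c, wco c = wl cs (co1 c) := fun c => long_uniq cs (hwco c) (wl_spec cs _)
  have e2 : ∀ c c', wco2 c c' = wl cs (co2 c c') := fun c c' =>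
    long_uniq cs (hwco2 c c') (wl_spec cs _)
  simp only [e1, e2] at *
  have hne : ∀ i, u i ≠ u (i + 1) ∧ u (i + 2) = tau cs (u i) (u (i + 1)) := by
    intro i
    induction i with
    | zero => exact ⟨hu, tau_eq cs hu (hurec 0)⟩
    | succ i ih =>
      have : u (i + 1) ≠ u (i + 2) := by rw [ih.2]; exact (tau_ne cs ih.1).symm
      exact ⟨this, tau_eq cs this (hurec (i + 1))⟩
  have hs := fun k => FF_seq cs k u (fun i => (hne i).2)
  have hxF : ∀ i, x i = wl cs (co2 (u 0) (u 1)) * (FF cs i (u 0) (u 1))⁻¹ := by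
    intro i
    induction i with
    | zero => simp [hx0, FF]
    | succ i ih =>
      rw [hx, ih, (hs i).1, vv, mul_inv_rev, mul_inv_rev, long_inv cs (wl_spec cs _),
        long_inv cs (wl_spec cs _)]
      simp only [mul_assoc]
  have hxl : ∀ i, cs.length (x i) = cs.length (FF cs i (u 0) (u 1) * wl cs (co2 (u 0) (u 1))) := by
    intro i
    rw [hxF, ← cs.length_inv, mul_inv_rev, inv_inv, long_inv cs (wl_spec cs _)]
  induction k with
  | zero => simp [Good_zero]
  | succ k ih =>
    have hv := vv_len cs (u k) (u (k + 1))
    have hL := (hs k).2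
    constructor
    · intro h
      have h1 := ih.1 (fun i hi => h i (by omega))
      have h2 := h k (by omega)
      rw [hxl, hxl] at h2
      unfold Good at h1 ⊢
      omega
    · intro h i hi
      have h1 := Good_pred cs h
      rcases Nat.lt_succ_iff_lt_or_eq.1 hi with h2 | rfl
      · exact ih.2 h1 i h2
      · rw [hxl, hxl]
        unfold Good at h h1
        omega

end Top



section AtomicLength
open Classical
variable [Finite W] (cs : CoxeterSystem M W)

lemma at_step {I J : Set B} {m : ℕ} (E : RAtomExpr cs I J m) {i : ℕ} (him : i + 1 ≤ m)
    (ih : ∀ p q : B, p ≠ q → E.Lset i = co2 p q →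
      (Good cs i p q ∧ E.x i * wl cs (co2 p q) = FF cs i p q) ∨
      (Good cs i q p ∧ E.x i * wl cs (co2 p q) = FF cs i q p))
    {p q : B} (hpq : p ≠ q) (hL : E.Lset (i + 1) = co2 p q) (ht : E.tletter (i + 1) = p) :
    Good cs (i + 1) p q ∧ E.x (i + 1) * wl cs (co2 p q) = FF cs (i + 1) p q := by
  have h1 : 1 ≤ i + 1 := by omega
  have hmem := E.hmem _ h1 him
  have hwK := E.hwK _ h1 him
  have hts := E.ht _ h1 him
  have hLi := E.hLi _ h1 him
  have hx := E.hx _ h1 him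
  have hred := E.hred _ h1 him
  have hwL := E.hwL i (by omega)
  simp only [Nat.add_sub_cancel] at hmem hwK hts hLi hx hred
  rw [ht] at hts hLi
  rw [hL] at hLi
  have hpK : p ∈ E.Lset i ∪ {E.letter (i + 1)} := by
    rw [← simple_mem_par_iff cs, hts]
    exact mul_mem (mul_mem hwK.1 (simple_mem_par cs (Or.inr rfl))) hwK.1
  have hK : E.Lset i ∪ {E.letter (i + 1)} = co1 q := by
    ext j
    have hj : j ∈ co2 p q ↔ j ∈ (E.Lset i ∪ {E.letter (i + 1)}) \ {p} := by rw [← hLi]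
    rw [Set.mem_sdiff, Set.mem_singleton_iff, mem_co2] at hj
    rw [mem_co1]
    by_cases hjp : j = p
    · subst hjp
      exact ⟨fun _ => hpq, fun _ => hpK⟩
    · exact ⟨fun h => (hj.2 ⟨h, hjp⟩).2, fun h => (hj.1 ⟨hjp, h⟩).1⟩
  rw [hK] at hwK
  have eK : E.wK (i + 1) = wl cs (co1 q) := long_uniq cs hwK (wl_spec cs _)
  rw [eK] at hts hx hred
  have hs : E.letter (i + 1) = tau cs p q := by
    apply tau_eq cs hpq
    rw [hts]
    have := long_sq cs (wl_spec cs (co1 q))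
    calc _ = (wl cs (co1 q) * wl cs (co1 q)) * cs.simple (E.letter (i + 1)) *
          (wl cs (co1 q) * wl cs (co1 q)) := by simp [this]
      _ = _ := by simp only [mul_assoc]
  have hLL : E.Lset i = co2 q (tau cs p q) := by
    ext j
    have hj : j ∈ co1 q ↔ j ∈ E.Lset i ∪ {E.letter (i + 1)} := by rw [hK]
    rw [mem_co1, Set.mem_union, Set.mem_singleton_iff, hs] at hj
    rw [hs] at hmem
    rw [mem_co2]
    constructor
    · intro h
      refine ⟨hj.2 (Or.inl h), ?_⟩
      rintro rfl
      exact hmem h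
    · rintro ⟨h2, h3⟩
      exact (hj.1 h2).resolve_right h3
  rw [hLL] at hwL
  have eL : E.wL i = wl cs (co2 q (tau cs p q)) := long_uniq cs hwL (wl_spec cs _)
  rw [eL] at hx hred
  have hne := (tau_ne cs hpq).symm
  have hJJ := long_sq cs (wl_spec cs (co2 q (tau cs p q)))
  have hv := vv_len cs p q
  have hxi : E.x i = E.x i * wl cs (co2 q (tau cs p q)) * wl cs (co2 q (tau cs p q)) := by
    rw [mul_assoc, hJJ, mul_one]
  have fin : Good cs i q (tau cs p q) → E.x i * wl cs (co2 q (tau cs p q)) =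
      FF cs i q (tau cs p q) →
      Good cs (i + 1) p q ∧ E.x (i + 1) * wl cs (co2 p q) = FF cs (i + 1) p q := by
    intro g1 g2
    have e1 : E.x (i + 1) * wl cs (co2 p q) = FF cs (i + 1) p q := by
      rw [hx, g2, FF, vv, mul_assoc]
    refine ⟨?_, e1⟩
    unfold Good at g1 ⊢
    rw [← e1, mul_assoc, long_sq cs (wl_spec cs _), mul_one, Lam]
    rw [← g2, ← hxi] at g1
    omega
  rcases ih q (tau cs p q) hne hLL with ⟨g1, g2⟩ | ⟨g1, g2⟩
  · exact fin g1 g2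
  · cases i with
    | zero => exact fin (Good_zero cs _ _) g2
    | succ n =>
      exfalso
      have hd := Good_desc cs hne.symm g1
      have hl := Good_len cs g1
      unfold Good at g1
      rw [co2_comm (tau cs p q) q, ← g2, ← hxi] at g1
      rw [← g2] at hd hl
      rw [hx] at hred
      have hb := (wl_spec cs (co1 q)).2 (cs.simple (tau cs p q) * wl cs (co1 q))
        (mul_mem (simple_mem_par cs (mem_co1.2 hne.symm)) (wl_spec cs (co1 q)).1)
      have hc := cs.length_mul_le
        (E.x (n + 1) * wl cs (co2 q (tau cs p q)) * cs.simple (tau cs p q))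
        (cs.simple (tau cs p q) * wl cs (co1 q))
      have he : E.x (n + 1) * wl cs (co2 q (tau cs p q)) * cs.simple (tau cs p q) *
          (cs.simple (tau cs p q) * wl cs (co1 q)) =
          E.x (n + 1) * wl cs (co2 q (tau cs p q)) * wl cs (co1 q) := by
        simp [mul_assoc]
      rw [he] at hc
      omega

lemma at_fwd {I J : Set B} {m : ℕ} (E : RAtomExpr cs I J m) (i : ℕ) : i ≤ m →
    ∀ p q : B, p ≠ q → E.Lset i = co2 p q →
      (Good cs i p q ∧ E.x i * wl cs (co2 p q) = FF cs i p q) ∨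
      (Good cs i q p ∧ E.x i * wl cs (co2 p q) = FF cs i q p) := by
  induction i with
  | zero =>
    intro _ p q _ hL
    left
    refine ⟨Good_zero cs _ _, ?_⟩
    have h := E.hwL 0 (by omega)
    rw [hL] at h
    rw [E.hx0, long_uniq cs h (wl_spec cs _), long_sq cs (wl_spec cs _), FF]
  | succ i ih =>
    intro him p q hpq hL
    have ih' := ih (by omega)
    have h : E.tletter (i + 1) ∉ co2 p q := by
      rw [← hL, E.hLi _ (by omega) him]
      simp
    rw [mem_co2] at h
    by_cases h1 : E.tletter (i + 1) = p
    · exact Or.inl (at_step cs E him ih' hpq hL h1)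
    · have h2 : E.tletter (i + 1) = q := by tauto
      right
      have := at_step cs E him ih' hpq.symm (by rw [hL, co2_comm]) h2
      rwa [co2_comm q p] at this

lemma img_FF {p q : B} (hpq : p ≠ q) (k : ℕ) :
    img cs (co2 p q) (FF cs k p q) = co2 (useq cs p q k) (useq cs p q (k + 1)) := by
  induction k with
  | zero =>
    ext i
    constructor
    · rintro ⟨j, hj, e⟩
      simp only [FF, one_mul, inv_one, mul_one] at e
      rw [← simple_inj cs e]
      exact hj
    · intro hi
      exact ⟨i, hi, by simp [FF]⟩
  | succ k ih =>
    have hne := useq_ne cs hpq k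
    ext i
    constructor
    · rintro ⟨j, hj, e⟩
      obtain ⟨l, hl⟩ := FF_conj cs k hpq j hj
      have hl' : l ∈ co2 (useq cs p q k) (useq cs p q (k + 1)) := by
        rw [← ih]; exact ⟨j, hj, hl⟩
      obtain ⟨i', hi', e'⟩ := vv_conj cs hne hl'
      have : cs.simple i = cs.simple i' := by
        rw [← e, ← e', ← hl, FF_succ]
        group
      rw [simple_inj cs this]
      exact hi'
    · intro hi
      obtain ⟨l, hl, e⟩ := vv_conj' cs hne hi
      rw [← ih] at hl
      obtain ⟨j, hj, e2⟩ := hl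
      refine ⟨j, hj, ?_⟩
      rw [← e, ← e2, FF_succ]
      group

lemma FF_quot_le (p q : B) {n k : ℕ} (h : n ≤ k) :
    cs.length (FF cs k p q * (FF cs n p q)⁻¹) + Lam cs n p q ≤ Lam cs k p q := by
  induction k, h using Nat.le_induction with
  | base => simp
  | succ k hk ih =>
    rw [FF_succ, Lam_succ, mul_assoc]
    have := cs.length_mul_le (vv cs (useq cs p q k) (useq cs p q (k + 1)))
      (FF cs k p q * (FF cs n p q)⁻¹)
    omega

lemma at_bwd {p q : B} (hpq : p ≠ q) {k : ℕ} (hg : Good cs k p q) :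
    AtLen cs (co2 p q) (img cs (co2 p q) (FF cs k p q), FF cs k p q) k := by
  have hX := Good_Xc cs hpq hg
  have hJ := wl_spec cs (co2 p q)
  refine ⟨FF cs k p q * wl cs (co2 p q), (max_dcos cs hX hJ).2 rfl, ?_⟩
  set U := useq cs p q with hU
  have hne : ∀ n, U n ≠ U (n + 1) := useq_ne cs hpq
  have hUt : ∀ n, U (n + 2) = tau cs (U n) (U (n + 1)) := fun _ => rfl
  have hI := img_FF cs hpq k
  rw [← hU] at hI
  set w0 := wl cs (co2 (U k) (U (k + 1))) with hw0
  have hw0e : w0 = FF cs k p q * wl cs (co2 p q) * (FF cs k p q)⁻¹ := conj_eq_of_img cs hX hI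
  have hw0F : w0 * FF cs k p q = FF cs k p q * wl cs (co2 p q) := by
    rw [hw0e]; group
  have hw0l : cs.length w0 = cs.length (wl cs (co2 p q)) := by
    rw [hw0e]; exact Xc_len cs hX _ hJ.1
  have hxl : ∀ n ≤ k, cs.length (w0 * FF cs k p q * (FF cs n p q)⁻¹) + Lam cs n p q =
      cs.length w0 + Lam cs k p q := by
    intro n hn
    have h1 := FF_quot_le cs p q hn
    have h2 := cs.length_mul_le w0 (FF cs k p q * (FF cs n p q)⁻¹)
    have h3 := cs.length_mul_le (w0 * FF cs k p q * (FF cs n p q)⁻¹) (FF cs n p q)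
    have h4 := FF_le cs n p q
    rw [inv_mul_cancel_right, hw0F] at h3
    unfold Good at hg
    rw [← mul_assoc] at h2
    rw [hw0F] at h2 ⊢
    omega
  have hKe : ∀ n, co2 (U (n + 1)) (U (n + 2)) ∪ {U (n + 2)} = co1 (U (n + 1)) := by
    intro n
    ext j
    rw [Set.mem_union, mem_co2, mem_co1, Set.mem_singleton_iff]
    have := hne (n + 1)
    constructor
    · rintro (h | rfl)
      · exact h.1
      · exact this.symm
    · intro h
      by_cases h2 : j = U (n + 2)
      · exact Or.inr h2
      · exact Or.inl ⟨h, h2⟩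
  have hsub : ∀ i, 1 ≤ i → i ≤ k → k - (i - 1) = (k - i) + 1 := by intros; omega
  refine ⟨{
    Lset := fun i => co2 (U (k - i)) (U (k - i + 1))
    letter := fun i => U (k - i + 2)
    tletter := fun i => U (k - i)
    wL := fun i => wl cs (co2 (U (k - i)) (U (k - i + 1)))
    wK := fun i => wl cs (co1 (U (k - i + 1)))
    x := fun i => w0 * FF cs k p q * (FF cs (k - i) p q)⁻¹
    hL0 := by simp only [Nat.sub_zero]; exact hI.symm
    hLm := by simp only [Nat.sub_self]; rfl
    hwL := fun i _ => wl_spec cs _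
    hmem := ?_
    hfinK := fun i _ _ => Set.toFinite _
    hwK := ?_
    ht := fun i _ _ => tau_spec' cs (hne _)
    hLi := ?_
    hx0 := by simp [hw0]
    hx := ?_
    hred := ?_ }, ?_⟩
  · intro i h1 h2
    simp only [hsub i h1 h2, mem_co2]
    exact fun h => h.2 rfl
  · intro i h1 h2
    simp only [hsub i h1 h2]
    rw [hKe]
    exact wl_spec cs _
  · intro i h1 h2
    simp only [hsub i h1 h2]
    rw [hKe]
    ext j
    rw [Set.mem_sdiff, mem_co2, mem_co1, Set.mem_singleton_iff, and_comm]
  · intro i h1 h2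
    simp only [hsub i h1 h2]
    have := vv_eq cs (hne (k - i))
    rw [← hUt] at this
    rw [FF_succ, ← hU, mul_inv_rev]
    calc _ = w0 * FF cs k p q * ((FF cs (k - i) p q)⁻¹ * ((vv cs (U (k - i)) (U (k - i + 1)))⁻¹ *
          vv cs (U (k - i)) (U (k - i + 1)))) := by simp
      _ = _ := by
        nth_rewrite 2 [this]
        simp only [mul_assoc]
  · intro i h1 h2
    have a1 := hxl (k - i) (by omega)
    have a2 := hxl (k - i + 1) (by omega)
    have a3 := wl_len cs (hne (k - i))
    have a4 := vv_len cs (U (k - i)) (U (k - i + 1))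
    have a5 := Lam_succ cs (k - i) p q
    rw [← hUt] at a3
    rw [← hU] at a5
    simp only [hsub i h1 h2]
    rw [show k - i + 1 + 1 = k - i + 2 from rfl]
    omega
  · simp only [Nat.sub_self, FF, inv_one, mul_one]
    exact hw0F

lemma at_iff {a b : B} (hab : a ≠ b) {p : Set B × W} (hp : p ∈ CoreRight cs (co2 a b)) (k : ℕ) :
    AtLen cs (co2 a b) p k ↔
      (Good cs k a b ∧ p.2 = FF cs k a b) ∨ (Good cs k b a ∧ p.2 = FF cs k b a) := by
  obtain ⟨I, x⟩ := p
  obtain ⟨hx, hI⟩ := (core_iff cs _ _).1 hp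
  simp only at hx hI
  subst hI
  constructor
  · rintro ⟨y, hy, E, rfl⟩
    have h1 := (max_dcos cs hx (wl_spec cs (co2 a b))).1 hy
    have h2 := at_fwd cs E k le_rfl a b hab E.hLm
    rwa [h1, mul_assoc, long_sq cs (wl_spec cs _), mul_one] at h2
  · rintro (⟨h1, h2⟩ | ⟨h1, h2⟩)
    · simp only at h2
      rw [h2]
      exact at_bwd cs hab h1
    · simp only at h2
      rw [h2, co2_comm]
      exact at_bwd cs hab.symm h1

end AtomicLength



section Counting
open Classical
variable [Finite W] (cs : CoxeterSystem M W)

lemma core_image (J : Set B) :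
    CoreRight cs J = (fun x => (img cs J x, x)) '' {x | Xc cs J x} := by
  ext ⟨I, x⟩
  rw [core_iff, Set.mem_image]
  constructor
  · rintro ⟨h1, h2⟩
    exact ⟨x, h1, by simp only at h2; rw [h2]⟩
  · rintro ⟨y, hy, e⟩
    simp only [Prod.mk.injEq] at e
    obtain ⟨e1, rfl⟩ := e
    exact ⟨hy, e1.symm⟩

lemma pair_inj (J : Set B) : Function.Injective (fun x : W => (img cs J x, x)) :=
  fun _ _ h => congrArg Prod.snd h

lemma at_image {a b : B} (hab : a ≠ b) (k : ℕ) :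
    {p ∈ CoreRight cs (co2 a b) | AtLen cs (co2 a b) p k} =
      (fun x => (img cs (co2 a b) x, x)) ''
        {x | (Good cs k a b ∧ x = FF cs k a b) ∨ (Good cs k b a ∧ x = FF cs k b a)} := by
  ext p
  rw [Set.mem_sep_iff, Set.mem_image]
  constructor
  · rintro ⟨h1, h2⟩
    have h3 := (at_iff cs hab h1 k).1 h2
    have h4 := ((core_iff cs _ _).1 h1).2
    exact ⟨p.2, h3, by rw [← h4]⟩
  · rintro ⟨x, hx, rfl⟩
    have h1 : (img cs (co2 a b) x, x) ∈ CoreRight cs (co2 a b) := by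
      refine (core_iff cs _ _).2 ⟨?_, rfl⟩
      rcases hx with ⟨h, rfl⟩ | ⟨h, rfl⟩
      · exact Good_Xc cs hab h
      · rw [co2_comm]
        exact Good_Xc cs hab.symm h
    exact ⟨h1, (at_iff cs hab h1 k).2 hx⟩

lemma count {wS : W} (hw : IsLongest cs Set.univ wS) {a b : B} (hab : a ≠ b) {d : ℕ}
    (hN : FF cs (d + 1) a b = wS * wl cs (co2 a b)) (hG : ∀ k, Good cs k a b ↔ k ≤ d + 1)
    (hN' : FF cs (d + 1) b a = wS * wl cs (co2 b a)) (hG' : ∀ k, Good cs k b a ↔ k ≤ d + 1) :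
    (CoreRight cs (co2 a b)).ncard = 2 * (d + 1) ∧
    {p ∈ CoreRight cs (co2 a b) | AtLen cs (co2 a b) p 0}.ncard = 1 ∧
    {p ∈ CoreRight cs (co2 a b) | AtLen cs (co2 a b) p (d + 1)}.ncard = 1 ∧
    ∀ k, 1 ≤ k → k ≤ d → {p ∈ CoreRight cs (co2 a b) | AtLen cs (co2 a b) p k}.ncard = 2 := by
  have hdisj : ∀ k l, k ≤ d + 1 → 1 ≤ l → l ≤ d → FF cs k a b ≠ FF cs l b a := by
    intro k l hk hl1 hl2 he
    have g2 := FF_not_desc cs hw hab.symm hN' hG' hl2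
    obtain ⟨l, rfl⟩ : ∃ m, l = m + 1 := ⟨l - 1, by omega⟩
    have g1 := Good_desc cs hab.symm ((hG' (l + 1)).2 (by omega))
    rw [← he] at g1 g2
    cases k with
    | zero => simp [FF] at g1
    | succ k => exact g2 (Good_desc cs hab ((hG _).2 hk))
  simp only [at_image cs hab, Set.ncard_image_of_injective _ (pair_inj cs _)]
  refine ⟨?_, ?_, ?_, ?_⟩
  · rw [core_image, Set.ncard_image_of_injective _ (pair_inj cs _)]
    have hset : {x | Xc cs (co2 a b) x} = (((Finset.range (d + 2)).image (fun k => FF cs k a b) ∪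
        (Finset.Icc 1 d).image (fun k => FF cs k b a) : Finset W) : Set W) := by
      ext x
      simp only [Set.mem_ofPred_eq, Finset.coe_union, Finset.coe_image, Set.mem_union,
        Set.mem_image, Finset.coe_range, Set.mem_Iio, Finset.coe_Icc, Set.mem_Icc]
      constructor
      · intro hx
        by_cases hp : cs.length (x * cs.simple a) < cs.length x
        · obtain ⟨k, h1, h2⟩ := complete cs _ hab rfl hx hp
          have := (hG _).1 h1
          exact Or.inl ⟨k + 1, by omega, h2.symm⟩
        by_cases hq : cs.length (x * cs.simple b) < cs.length x
        · obtain ⟨k, h1, h2⟩ := complete cs _ hab.symm rfl (by rw [co2_comm]; exact hx) hq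
          have := (hG' _).1 h1
          refine Or.inr ⟨k + 1, ⟨by omega, ?_⟩, h2.symm⟩
          by_contra hc
          have : k + 1 = d + 1 := by omega
          rw [this, hN'] at h2
          rw [h2] at hp
          exact hp (top_desc cs hw (by simp [mem_co2]))
        · left
          refine ⟨0, by omega, ?_⟩
          by_contra h1
          obtain ⟨i, hi⟩ := cs.exists_rightDescent_of_ne_one (w := x)
            (fun h => h1 (by rw [h, FF]))
          unfold CoxeterSystem.IsRightDescent at hi
          by_cases hia : i = a
          · exact hp (hia ▸ hi)
          by_cases hib : i = b
          · exact hq (hib ▸ hi)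
          have := hx.1 i (mem_co2.2 ⟨hia, hib⟩)
          omega
      · rintro (⟨k, hk, rfl⟩ | ⟨k, hk, rfl⟩)
        · exact Good_Xc cs hab ((hG k).2 (by omega))
        · rw [co2_comm]
          exact Good_Xc cs hab.symm ((hG' k).2 (by omega))
    rw [hset, Set.ncard_coe_finset, Finset.card_union_of_disjoint, Finset.card_image_of_injOn,
      Finset.card_image_of_injOn, Finset.card_range, Nat.card_Icc]
    · omega
    · intro k hk l hl h
      simp only [Finset.coe_Icc, Set.mem_Icc] at hk hl
      exact FF_inj cs hab.symm ((hG' k).2 (by omega)) ((hG' l).2 (by omega)) h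
    · intro k hk l hl h
      simp only [Finset.coe_range, Set.mem_Iio] at hk hl
      exact FF_inj cs hab ((hG k).2 (by omega)) ((hG l).2 (by omega)) h
    · rw [Finset.disjoint_left]
      intro x hx hx'
      rw [Finset.mem_image] at hx hx'
      obtain ⟨k, hk, rfl⟩ := hx
      obtain ⟨l, hl, e⟩ := hx'
      rw [Finset.mem_range] at hk
      rw [Finset.mem_Icc] at hl
      exact hdisj k l (by omega) hl.1 hl.2 e.symm
  · rw [Set.ncard_eq_one]
    refine ⟨1, ?_⟩
    ext x
    simp [Good_zero, FF]
  · rw [Set.ncard_eq_one]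
    refine ⟨wS * wl cs (co2 a b), ?_⟩
    ext x
    simp [hG, hG', hN, hN', co2_comm b a]
  · intro k h1 h2
    rw [Set.ncard_eq_two]
    refine ⟨FF cs k a b, FF cs k b a, hdisj k k (by omega) h1 h2, ?_⟩
    ext x
    have h3 : k ≤ d + 1 := by omega
    simp [hG, hG', h3]

end Counting

theorem statement_19 (cs : CoxeterSystem M W) [Finite W] (wS : W)
    (hwS : ∀ w : W, cs.length w ≤ cs.length wS)
    (J : Set B) (a b : B) (hab : a ≠ b) (hJc : Set.univ \ J = {a, b})
    (wco : B → W) (hwco : ∀ c, IsLongest cs (Set.univ \ {c}) (wco c))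
    (wco2 : B → B → W) (hwco2 : ∀ c c', IsLongest cs (Set.univ \ {c, c'}) (wco2 c c'))
    (u : ℕ → B)
    (hurec : ∀ i, cs.simple (u (i + 2)) = wco (u (i + 1)) * cs.simple (u i) * wco (u (i + 1)))
    (x : ℕ → W)
    (hx0 : x 0 = wco2 (u 0) (u 1))
    (hx : ∀ i, x (i + 1) = x i * wco2 (u i) (u (i + 1)) * wco (u (i + 1)))
    (d : ℕ)
    (hd : ∀ i ≤ d, (cs.length (x (i + 1)) : ℤ) =
      (cs.length (x i) : ℤ) - cs.length (wco2 (u i) (u (i + 1))) + cs.length (wco (u (i + 1))))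
    (hdmax : ∀ k : ℕ, (∀ i ≤ k, (cs.length (x (i + 1)) : ℤ) =
        (cs.length (x i) : ℤ) - cs.length (wco2 (u i) (u (i + 1)))
          + cs.length (wco (u (i + 1)))) → k ≤ d)
    (hu0 : cs.simple (u 0) = wS * cs.simple b * wS)
    (hu1 : cs.simple (u 1) = wS * cs.simple a * wS) :
    (CoreRight cs J).ncard = 2 * (d + 1) ∧
    {p ∈ CoreRight cs J | AtLen cs J p 0}.ncard = 1 ∧
    {p ∈ CoreRight cs J | AtLen cs J p (d + 1)}.ncard = 1 ∧
    ∀ k, 1 ≤ k → k ≤ d → {p ∈ CoreRight cs J | AtLen cs J p k}.ncard = 2 := by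
  have hw := long_univ cs hwS
  have hJ : J = co2 a b := by
    rw [co2, ← hJc]
    simp
  subst hJ
  have hu : u 0 ≠ u 1 := fun h => hab.symm ((bar_iff cs hw hu1 hu0).2 h)
  have hdg := d_good cs wco hwco wco2 hwco2 u hu hurec x hx0 hx
  obtain ⟨N, hN, hG⟩ := top_exists cs hw hab
  obtain ⟨N', hN', hG'⟩ := top_exists cs hw hab.symm
  have hNN : N = N' :=
    le_antisymm (N_le cs hw hab hN hG hN' hG') (N_le cs hw hab.symm hN' hG' hN hG)
  have hg : ∀ k, Good cs k (u 0) (u 1) ↔ k ≤ N' + 1 := fun k =>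
    (bar_Good cs hw k hab.symm hu0 hu1).trans (hG' k)
  have h1 : d + 1 ≤ N' + 1 := (hg _).1 ((hdg (d + 1)).1 (fun i hi => hd i (by omega)))
  have h2 : N' ≤ d := hdmax N' (fun i hi => (hdg (N' + 1)).2 ((hg _).2 le_rfl) i (by omega))
  have h3 : N' = d := by omega
  subst h3
  subst hNN
  exact count cs hw hab hN hG hN' hG'



end CoxeterAtoms
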